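/- arXiv:2206.10522 — 9 statements merged into one kernel-verified Lean document; each statement's English description precedes it below -/
import Mathlib

section
/- Let 𝕂 be a field, n ≥ 2, N = n(n−1)/2, p_1,…,p_N ∈ 𝕂ˣ, and set u₁ := x_{i′_1}(p_1)·x_{i′_2}(p_2)⋯x_{i′_N}(p_N) with (i′_1,…,i′_N) = 𝐢′₀. Define m_1,…,m_N ∈ 𝕂ˣ by m_{s_k+a} := (∏_{r=1}^{k} p_{s_{r+1}−a+1}) / (∏_{r=1}^{k−1} p_{s_{r+1}−a}) for 1 ≤ k ≤ n−1 and 1 ≤ a ≤ n−k (empty products equal 1). Then there exists an invertible upper triangular matrix B over 𝕂 such that u₁·w̄₀ = y_{i_1}(m_1⁻¹)·y_{i_2}(m_2⁻¹)⋯y_{i_N}(m_N⁻¹)·B, where (i_1,…,i_N) = 𝐢₀. -/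
open Matrix

/-- `yMat n 𝕂 i z` is the n×n identity matrix except entry (i+1, i) (1-based) equals `z`. -/
def yMat (n : ℕ) (𝕂 : Type*) [Field 𝕂] (i : ℕ) (z : 𝕂) :
    Matrix (Fin n) (Fin n) 𝕂 :=
  fun a b => if a = b then 1 else if (a : ℕ) = i ∧ (b : ℕ) + 1 = i then z else 0

/-- `xMat n 𝕂 i z` is the n×n identity matrix except entry (i, i+1) (1-based) equals `z`. -/
def xMat (n : ℕ) (𝕂 : Type*) [Field 𝕂] (i : ℕ) (z : 𝕂) :
    Matrix (Fin n) (Fin n) 𝕂 :=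
  fun a b => if a = b then 1 else if (a : ℕ) + 1 = i ∧ (b : ℕ) = i then z else 0

/-- `xNegMat n 𝕂 i z` is the identity except the 2×2 block in rows/cols i, i+1 (1-based)
equals [[z⁻¹, 0], [1, z]]. -/
noncomputable def xNegMat (n : ℕ) (𝕂 : Type*) [Field 𝕂] (i : ℕ) (z : 𝕂) :
    Matrix (Fin n) (Fin n) 𝕂 :=
  fun a b =>
    if (a : ℕ) + 1 = i ∧ (b : ℕ) + 1 = i then z⁻¹
    else if (a : ℕ) = i ∧ (b : ℕ) = i then z
    else if (a : ℕ) = i ∧ (b : ℕ) + 1 = i then 1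
    else if a = b then 1 else 0

/-- The matrix w̄₀ with (i, n+1−i) entry (−1)^(n−i) (1-based) and other entries 0. -/
def w0bar (n : ℕ) (𝕂 : Type*) [Field 𝕂] : Matrix (Fin n) (Fin n) 𝕂 :=
  fun a b => if (a : ℕ) + (b : ℕ) = n - 1 then (-1 : 𝕂) ^ (n - 1 - (a : ℕ)) else 0

/-- s_k = Σ_{j=1}^{k−1} (n−j). -/
def sIdx (n k : ℕ) : ℕ := ∑ j ∈ Finset.Icc 1 (k - 1), (n - j)

/-- The word 𝐢₀ = (1,2,…,n−1, 1,2,…,n−2, …, 1,2, 1). -/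
def wordI0 (n : ℕ) : List ℕ :=
  (List.range (n - 1)).flatMap (fun k => (List.range (n - 1 - k)).map (· + 1))

/-- The word 𝐢′₀ = (n−1,…,1, n−1,…,2, …, n−1,n−2, n−1). -/
def wordI0' (n : ℕ) : List ℕ :=
  (List.range (n - 1)).flatMap (fun k => (List.range (n - 1 - k)).map (fun a => n - 1 - a))

/-- The simple reflection s_i = (i, i+1) (1-based) as a permutation of `Fin n`. -/
def sPerm (n i : ℕ) : Equiv.Perm (Fin n) :=
  if h : 1 ≤ i ∧ i < n then Equiv.swap ⟨i - 1, by omega⟩ ⟨i, h.2⟩ else 1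

/-- The longest element of S_n, k ↦ n+1−k (1-based). -/
def w0Perm (n : ℕ) : Equiv.Perm (Fin n) where
  toFun a := ⟨n - 1 - (a : ℕ), by have := a.isLt; omega⟩
  invFun a := ⟨n - 1 - (a : ℕ), by have := a.isLt; omega⟩
  left_inv a := by
    have := a.isLt
    apply Fin.ext
    show n - 1 - (n - 1 - (a : ℕ)) = (a : ℕ)
    omega
  right_inv a := by
    have := a.isLt
    apply Fin.ext
    show n - 1 - (n - 1 - (a : ℕ)) = (a : ℕ)
    omega

/-- Apply a permutation of `Fin n` to a 1-based label in {1, …, n}. -/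
def permApp {n : ℕ} (σ : Equiv.Perm (Fin n)) (x : ℕ) : ℕ :=
  if h : 1 ≤ x ∧ x ≤ n then ((σ ⟨x - 1, by omega⟩ : Fin n) : ℕ) + 1 else x

section Products

theorem List.prod_map_one_add_of_mul_eq_zero {R : Type*} [Semiring R] (E : ℕ → R) (t : ℕ)
    (h : ∀ a b, a < b → b < t → E a * E b = 0) :
    ((List.range t).map fun a => 1 + E a).prod = 1 + ∑ a ∈ Finset.range t, E a := by
  induction t with
  | zero => simp
  | succ t ih =>
    rw [List.range_succ, List.map_append, List.prod_append,
      ih fun a b hab hb => h a b hab (by omega), Finset.sum_range_succ]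
    have h0 : (∑ a ∈ Finset.range t, E a) * E t = 0 := by
      rw [Finset.sum_mul]
      exact Finset.sum_eq_zero fun a ha => h a t (Finset.mem_range.1 ha) (by omega)
    simp [mul_add, add_mul, h0, add_assoc]

theorem Matrix.list_prod_mul_intertwine {R m n ι : Type*} [CommSemiring R] [Fintype m]
    [DecidableEq m] [Fintype n] [DecidableEq n] (l : List ι) (A : ι → Matrix m m R)
    (A' : ι → Matrix n n R) (J : Matrix m n R) (h : ∀ i ∈ l, A i * J = J * A' i) :
    (l.map A).prod * J = J * (l.map A').prod := by
  induction l with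
  | nil => simp
  | cons i l ih =>
    rw [List.map_cons, List.map_cons, List.prod_cons, List.prod_cons, Matrix.mul_assoc,
      ih fun j hj => h j (List.mem_cons_of_mem _ hj), ← Matrix.mul_assoc,
      h i List.mem_cons_self, Matrix.mul_assoc]

theorem List.prod_map_range_getD_flatMap {R : Type*} [Monoid R] (F : ℕ → ℕ → R)
    (len : ℕ → ℕ) (g : ℕ → ℕ → ℕ) (K : ℕ) :
    ((List.range (∑ k ∈ Finset.range K, len k)).map fun t =>
      F (((List.range K).flatMap fun k => (List.range (len k)).map (g k)).getD t 0) t).prod =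
    ((List.range K).map fun k => ((List.range (len k)).map fun a =>
      F (g k a) (∑ j ∈ Finset.range k, len j + a)).prod).prod := by
  induction K with
  | zero => simp
  | succ K ih =>
    have hlen : ((List.range K).flatMap fun k => (List.range (len k)).map (g k)).length =
        ∑ k ∈ Finset.range K, len k := by
      simp only [List.length_flatMap, List.length_map, List.length_range]
      rfl
    rw [Finset.sum_range_succ, List.range_succ (n := K), List.range_add, List.flatMap_append,
      List.map_append, List.map_append, List.prod_append, List.prod_append, ← ih,
      List.map_singleton, List.prod_singleton]
    congr 2
    · refine List.map_congr_left fun t ht => ?_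
      rw [List.getD_append _ _ _ _ (by rw [hlen]; exact List.mem_range.1 ht)]
    · simp only [List.map_map, List.flatMap_singleton]
      refine List.map_congr_left fun a ha => ?_
      have ha' := List.mem_range.1 ha
      simp only [Function.comp_apply]
      rw [List.getD_append_right _ _ _ _ (by omega), hlen, Nat.add_sub_cancel_left,
        List.getD_eq_getElem _ _ (by simpa using ha')]
      simp

end Products

section Elementary

variable {𝕂 : Type*} [Field 𝕂]

theorem xMat_eq_one_add_single {n : ℕ} (i : Fin n) (j : Fin n) (hij : (i : ℕ) + 1 = j) (z : 𝕂) :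
    xMat n 𝕂 j z = 1 + Matrix.single i j z := by
  ext a b
  simp only [xMat, Matrix.add_apply, Matrix.one_apply, Matrix.single_apply, Fin.ext_iff]
  split_ifs <;> first | omega | simp

theorem yMat_eq_one_add_single {n : ℕ} (i : Fin n) (j : Fin n) (hij : (j : ℕ) + 1 = i) (z : 𝕂) :
    yMat n 𝕂 i z = 1 + Matrix.single i j z := by
  ext a b
  simp only [yMat, Matrix.add_apply, Matrix.one_apply, Matrix.single_apply, Fin.ext_iff]
  split_ifs <;> first | omega | simp

theorem det_xMat {n i : ℕ} (hi : 1 ≤ i) (hin : i < n) (z : 𝕂) : (xMat n 𝕂 i z).det = 1 := by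
  have h := xMat_eq_one_add_single (n := n) ⟨i - 1, by omega⟩ ⟨i, hin⟩
    (by simp only; omega) z
  rw [show xMat n 𝕂 i z = _ from h]
  exact Matrix.det_transvection_of_ne _ _ (by simp only [ne_eq, Fin.mk.injEq]; omega) z

theorem det_yMat {n i : ℕ} (hi : 1 ≤ i) (hin : i < n) (z : 𝕂) : (yMat n 𝕂 i z).det = 1 := by
  have h := yMat_eq_one_add_single (n := n) ⟨i, hin⟩ ⟨i - 1, by omega⟩
    (by simp only; omega) z
  rw [show yMat n 𝕂 i z = _ from h]
  exact Matrix.det_transvection_of_ne _ _ (by simp only [ne_eq, Fin.mk.injEq]; omega) z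

theorem det_list_prod_eq_one {n : ℕ} (l : List (Matrix (Fin n) (Fin n) 𝕂))
    (h : ∀ A ∈ l, A.det = 1) : l.prod.det = 1 := by
  induction l with
  | nil => simp
  | cons A l ih =>
    rw [List.prod_cons, Matrix.det_mul, h A List.mem_cons_self,
      ih fun C hC => h C (List.mem_cons_of_mem _ hC), one_mul]

theorem isUnit_det_w0bar (n : ℕ) : IsUnit (w0bar n 𝕂).det := by
  have h : w0bar n 𝕂 * (w0bar n 𝕂)ᵀ = 1 := by
    ext a b
    rw [Matrix.mul_apply, Finset.sum_eq_single (Fin.rev a)]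
    · simp only [w0bar, Matrix.transpose_apply, Matrix.one_apply, Fin.val_rev, Fin.ext_iff]
      have := a.isLt
      have := b.isLt
      by_cases hab : (a : ℕ) = b
      · rw [if_pos (by omega), if_pos (by omega), if_pos hab, hab, ← mul_pow]
        simp
      · rw [if_neg hab, if_neg (show ¬ (b : ℕ) + (n - (a + 1)) = n - 1 by omega), mul_zero]
    · intro c _ hc
      have : ¬ (a : ℕ) + c = n - 1 := fun hac => hc (Fin.ext (by rw [Fin.val_rev]; omega))
      simp [w0bar, this]
    · simp
  have h' := congrArg Matrix.det h
  rw [Matrix.det_mul, Matrix.det_one] at h'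
  exact IsUnit.of_mul_eq_one _ h'

/-- The inclusion of `𝕂 ^ s` into `𝕂 ^ (s + 1)` as the first `s` coordinates. -/
def inclInit (s : ℕ) (𝕂 : Type*) [Field 𝕂] : Matrix (Fin (s + 1)) (Fin s) 𝕂 :=
  (1 : Matrix (Fin (s + 1)) (Fin (s + 1)) 𝕂).submatrix id Fin.castSucc

/-- The inclusion of `𝕂 ^ s` into `𝕂 ^ (s + 1)` as the last `s` coordinates. -/
def inclTail (s : ℕ) (𝕂 : Type*) [Field 𝕂] : Matrix (Fin (s + 1)) (Fin s) 𝕂 :=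
  (1 : Matrix (Fin (s + 1)) (Fin (s + 1)) 𝕂).submatrix id Fin.succ

theorem mul_inclInit {s : ℕ} (A : Matrix (Fin (s + 1)) (Fin (s + 1)) 𝕂) :
    A * inclInit s 𝕂 = A.submatrix id Fin.castSucc := by
  ext a b
  simp [inclInit, Matrix.mul_apply, Matrix.one_apply]

theorem mul_inclTail {s : ℕ} (A : Matrix (Fin (s + 1)) (Fin (s + 1)) 𝕂) :
    A * inclTail s 𝕂 = A.submatrix id Fin.succ := by
  ext a b
  simp [inclTail, Matrix.mul_apply, Matrix.one_apply]

theorem inclInit_mul_castSucc {s : ℕ} (A : Matrix (Fin s) (Fin s) 𝕂) (a b : Fin s) :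
    (inclInit s 𝕂 * A) a.castSucc b = A a b := by
  simp [inclInit, Matrix.mul_apply, Matrix.one_apply]

theorem inclInit_mul_last {s : ℕ} (A : Matrix (Fin s) (Fin s) 𝕂) (b : Fin s) :
    (inclInit s 𝕂 * A) (Fin.last s) b = 0 := by
  simp [inclInit, Matrix.mul_apply, (Fin.castSucc_ne_last _).symm]

theorem inclTail_mul_succ {s : ℕ} (A : Matrix (Fin s) (Fin s) 𝕂) (a b : Fin s) :
    (inclTail s 𝕂 * A) a.succ b = A a b := by
  simp [inclTail, Matrix.mul_apply, Matrix.one_apply]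

theorem inclTail_mul_zero {s : ℕ} (A : Matrix (Fin s) (Fin s) 𝕂) (b : Fin s) :
    (inclTail s 𝕂 * A) 0 b = 0 := by
  simp [inclTail, Matrix.mul_apply, (Fin.succ_ne_zero _).symm]

theorem yMat_mul_inclInit {s i : ℕ} (hi : i < s) (z : 𝕂) :
    yMat (s + 1) 𝕂 i z * inclInit s 𝕂 = inclInit s 𝕂 * yMat s 𝕂 i z := by
  ext a b
  rw [mul_inclInit]
  induction a using Fin.lastCases with
  | last =>
    have := b.isLt
    rw [inclInit_mul_last]
    simp only [yMat, Matrix.submatrix_apply, id, Fin.ext_iff, Fin.val_last, Fin.val_castSucc]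
    rw [if_neg (by omega), if_neg (by omega)]
  | cast a =>
    rw [inclInit_mul_castSucc]
    simp [yMat]

theorem xMat_mul_inclTail {s i : ℕ} (hi : 1 ≤ i) (z : 𝕂) :
    xMat (s + 1) 𝕂 (i + 1) z * inclTail s 𝕂 = inclTail s 𝕂 * xMat s 𝕂 i z := by
  ext a b
  rw [mul_inclTail]
  induction a using Fin.cases with
  | zero =>
    rw [inclTail_mul_zero]
    simp only [xMat, Matrix.submatrix_apply, id, Fin.ext_iff, Fin.val_zero, Fin.val_succ]
    rw [if_neg (by omega)]
    exact if_neg (by omega)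
  | succ a =>
    rw [inclTail_mul_succ]
    simp [xMat]

theorem w0bar_mul_inclInit (s : ℕ) :
    w0bar (s + 1) 𝕂 * inclInit s 𝕂 = inclTail s 𝕂 * w0bar s 𝕂 := by
  ext a b
  have := b.isLt
  rw [mul_inclInit]
  induction a using Fin.cases with
  | zero =>
    rw [inclTail_mul_zero]
    simp only [w0bar, Matrix.submatrix_apply, id, Fin.val_zero, Fin.val_castSucc]
    exact if_neg (by omega)
  | succ a =>
    rw [inclTail_mul_succ]
    simp only [w0bar, Matrix.submatrix_apply, id, Fin.val_succ, Fin.val_castSucc]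
    rw [show s + 1 - 1 - ((a : ℕ) + 1) = s - 1 - a by omega]
    exact if_congr (by omega) rfl rfl

theorem yMat_mul_diagonal {n i : ℕ} (d : ℕ → 𝕂) (z z' : 𝕂) (h : z * d i = d (i + 1) * z') :
    yMat n 𝕂 (i + 1) z * Matrix.diagonal (fun j : Fin n => d j) =
      Matrix.diagonal (fun j : Fin n => d j) * yMat n 𝕂 (i + 1) z' := by
  ext a b
  rw [Matrix.mul_diagonal, Matrix.diagonal_mul]
  simp only [yMat, Fin.ext_iff]
  split_ifs with h1 h2
  · simp [h1]
  · rw [h2.1, show (b : ℕ) = i by omega, h]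
  · simp

theorem prod_xMat_eq_one_add_sum (s : ℕ) (q : ℕ → 𝕂) :
    ((List.range s).map fun a => xMat (s + 1) 𝕂 (s - a) (q a)).prod =
      1 + ∑ a ∈ Finset.range s, Matrix.single (Fin.ofNat (s + 1) (s - a - 1))
        (Fin.ofNat (s + 1) (s - a)) (q a) := by
  have hv : ∀ c, c < s + 1 → ((Fin.ofNat (s + 1) c : Fin (s + 1)) : ℕ) = c :=
    fun c hc => Nat.mod_eq_of_lt hc
  rw [← List.prod_map_one_add_of_mul_eq_zero]
  · refine congrArg _ (List.map_congr_left fun a ha => ?_)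
    have ha' := List.mem_range.1 ha
    rw [← xMat_eq_one_add_single _ _ (by rw [hv _ (by omega), hv _ (by omega)]; omega),
      hv _ (by omega)]
  · intro a b hab hb
    refine Matrix.single_mul_single_of_ne _ _ _ _ (fun h => ?_) _
    have := congrArg Fin.val h
    rw [hv _ (by omega), hv _ (by omega)] at this
    omega

theorem prod_yMat_eq_one_add_sum (s : ℕ) (c : ℕ → 𝕂) :
    ((List.range s).map fun a => yMat (s + 1) 𝕂 (a + 1) (c a)).prod =
      1 + ∑ a ∈ Finset.range s, Matrix.single (Fin.ofNat (s + 1) (a + 1))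
        (Fin.ofNat (s + 1) a) (c a) := by
  have hv : ∀ c, c < s + 1 → ((Fin.ofNat (s + 1) c : Fin (s + 1)) : ℕ) = c :=
    fun c hc => Nat.mod_eq_of_lt hc
  rw [← List.prod_map_one_add_of_mul_eq_zero]
  · refine congrArg _ (List.map_congr_left fun a ha => ?_)
    have ha' := List.mem_range.1 ha
    rw [← yMat_eq_one_add_single _ _ (by rw [hv _ (by omega), hv _ (by omega)]),
      hv _ (by omega)]
  · intro a b hab hb
    refine Matrix.single_mul_single_of_ne _ _ _ _ (fun h => ?_) _
    have := congrArg Fin.val h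
    rw [hv _ (by omega), hv _ (by omega)] at this
    omega

/-- Deleting the first column of a unipotent upper bidiagonal matrix gives, up to rescaling the
columns, a unipotent lower bidiagonal matrix with its last column deleted. -/
theorem prod_xMat_mul_inclTail (s : ℕ) (q : ℕ → 𝕂) (hq : ∀ a < s, q a ≠ 0) :
    ((List.range s).map fun a => xMat (s + 1) 𝕂 (s - a) (q a)).prod * inclTail s 𝕂 =
      ((List.range s).map fun a => yMat (s + 1) 𝕂 (a + 1) (q (s - 1 - a))⁻¹).prod *
        (inclInit s 𝕂 * Matrix.diagonal fun j : Fin s => q (s - 1 - j)) := by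
  have hv : ∀ c, c < s + 1 → ((Fin.ofNat (s + 1) c : Fin (s + 1)) : ℕ) = c :=
    fun c hc => Nat.mod_eq_of_lt hc
  rw [prod_xMat_eq_one_add_sum, prod_yMat_eq_one_add_sum, ← Matrix.mul_assoc, mul_inclTail,
    mul_inclInit]
  ext i j
  have hj := j.isLt
  have hi := i.isLt
  have hqj := hq (s - 1 - j) (by omega)
  rw [Matrix.mul_diagonal]
  simp only [Matrix.submatrix_apply, id, Matrix.add_apply, Matrix.sum_apply, Matrix.one_apply,
    Matrix.single_apply]
  rw [Finset.sum_eq_single (s - 1 - (j : ℕ)), Finset.sum_eq_single (j : ℕ)]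
  · simp only [Fin.ext_iff, Fin.val_succ, Fin.val_castSucc]
    rw [hv _ (by omega), hv _ (by omega), hv _ (by omega), hv _ (by omega)]
    by_cases h1 : (i : ℕ) = j
    · rw [if_neg (by omega), if_pos (by omega), if_pos h1, if_neg (by omega)]
      simp
    · by_cases h2 : (i : ℕ) = j + 1
      · rw [if_pos h2, if_neg (by omega), if_neg h1, if_pos (by omega)]
        simp [hqj]
      · rw [if_neg h2, if_neg (by omega), if_neg h1, if_neg (by omega)]
        simp
  · intro a ha haj
    have ha' := Finset.mem_range.1 ha
    refine if_neg fun h => haj ?_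
    have := congrArg Fin.val h.2
    rwa [hv _ (by omega), Fin.val_castSucc] at this
  · intro h
    exact absurd (Finset.mem_range.2 hj) h
  · intro a ha haj
    have ha' := Finset.mem_range.1 ha
    refine if_neg fun h => haj ?_
    have := congrArg Fin.val h.2
    rw [hv _ (by omega), Fin.val_succ] at this
    omega
  · intro h
    exact absurd (Finset.mem_range.2 (by omega)) h

end Elementary

section Triangular

variable {𝕂 : Type*} [Field 𝕂]

/-- The product of the `xMat` along the word `wordI0' (s + 1)`, where `q k a` is the parameter of
the letter in position `a` of row `k`. -/
def xProd (s : ℕ) (q : ℕ → ℕ → 𝕂) : Matrix (Fin (s + 1)) (Fin (s + 1)) 𝕂 :=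
  ((List.range s).map fun k =>
    ((List.range (s - k)).map fun a => xMat (s + 1) 𝕂 (s - a) (q k a)).prod).prod

/-- The product of the `yMat` along the word `wordI0 (s + 1)`, where `c k a` is the parameter of
the letter in position `a` of row `k`. -/
def yProd (s : ℕ) (c : ℕ → ℕ → 𝕂) : Matrix (Fin (s + 1)) (Fin (s + 1)) 𝕂 :=
  ((List.range s).map fun k =>
    ((List.range (s - k)).map fun a => yMat (s + 1) 𝕂 (a + 1) (c k a)).prod).prod

/-- The inverses of the ideal coordinates attached to the parameters `q`. -/
noncomputable def idealInv (s : ℕ) (q : ℕ → ℕ → 𝕂) (k a : ℕ) : 𝕂 :=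
  (∏ r ∈ Finset.range k, q r (s - 2 - r - a)) / ∏ r ∈ Finset.range (k + 1), q r (s - 1 - r - a)

theorem idealInv_zero (s : ℕ) (q : ℕ → ℕ → 𝕂) (a : ℕ) :
    idealInv s q 0 a = (q 0 (s - 1 - a))⁻¹ := by
  simp [idealInv]

theorem idealInv_succ (s : ℕ) (q : ℕ → ℕ → 𝕂) (k a : ℕ) (h : q 0 (s - a) ≠ 0) :
    idealInv (s + 1) q (k + 1) a * q 0 (s - a) =
      q 0 (s - (a + 1)) * idealInv s (fun r => q (r + 1)) k a := by
  have e1 : ∏ r ∈ Finset.range k, q (r + 1) (s + 1 - 2 - (r + 1) - a) =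
      ∏ r ∈ Finset.range k, q (r + 1) (s - 2 - r - a) :=
    Finset.prod_congr rfl fun r _ => congrArg _ (by omega)
  have e2 : ∏ r ∈ Finset.range (k + 1), q (r + 1) (s + 1 - 1 - (r + 1) - a) =
      ∏ r ∈ Finset.range (k + 1), q (r + 1) (s - 1 - r - a) :=
    Finset.prod_congr rfl fun r _ => congrArg _ (by omega)
  unfold idealInv
  rw [Finset.prod_range_succ' _ k, Finset.prod_range_succ' _ (k + 1), e1, e2,
    show s + 1 - 2 - 0 - a = s - (a + 1) by omega, show s + 1 - 1 - 0 - a = s - a by omega]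
  rw [div_mul_eq_mul_div, mul_div_mul_right _ _ h, mul_comm, mul_div_assoc]

theorem det_xProd (s : ℕ) (q : ℕ → ℕ → 𝕂) : (xProd s q).det = 1 := by
  refine det_list_prod_eq_one _ fun A hA => ?_
  obtain ⟨k, hk, rfl⟩ := List.mem_map.1 hA
  refine det_list_prod_eq_one _ fun C hC => ?_
  obtain ⟨a, ha, rfl⟩ := List.mem_map.1 hC
  have := List.mem_range.1 ha
  exact det_xMat (by omega) (by omega) _

theorem det_yProd (s : ℕ) (c : ℕ → ℕ → 𝕂) : (yProd s c).det = 1 := by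
  refine det_list_prod_eq_one _ fun A hA => ?_
  obtain ⟨k, hk, rfl⟩ := List.mem_map.1 hA
  refine det_list_prod_eq_one _ fun C hC => ?_
  obtain ⟨a, ha, rfl⟩ := List.mem_map.1 hC
  have := List.mem_range.1 ha
  exact det_yMat (by omega) (by omega) _

theorem xProd_succ_mul_inclTail (s : ℕ) (q : ℕ → ℕ → 𝕂) :
    xProd (s + 1) q * inclTail (s + 1) 𝕂 =
      ((List.range (s + 1)).map fun a => xMat (s + 2) 𝕂 (s + 1 - a) (q 0 a)).prod *
        (inclTail (s + 1) 𝕂 * xProd s fun k => q (k + 1)) := by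
  unfold xProd
  rw [List.range_succ_eq_map, List.map_cons, List.prod_cons, List.map_map, Matrix.mul_assoc,
    ← List.range_succ_eq_map]
  congr 1
  refine Matrix.list_prod_mul_intertwine _ _ _ _ fun k _ => ?_
  simp only [Function.comp_apply, Nat.succ_eq_add_one, Nat.add_sub_add_right]
  refine Matrix.list_prod_mul_intertwine _ _ _ _ fun a ha => ?_
  have := List.mem_range.1 ha
  rw [show s + 1 - a = s - a + 1 by omega]
  exact xMat_mul_inclTail (by omega) _

theorem yProd_succ_mul_inclInit (s : ℕ) (c : ℕ → ℕ → 𝕂) :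
    yProd (s + 1) c * inclInit (s + 1) 𝕂 =
      ((List.range (s + 1)).map fun a => yMat (s + 2) 𝕂 (a + 1) (c 0 a)).prod *
        (inclInit (s + 1) 𝕂 * yProd s fun k => c (k + 1)) := by
  unfold yProd
  rw [List.range_succ_eq_map, List.map_cons, List.prod_cons, List.map_map, Matrix.mul_assoc,
    ← List.range_succ_eq_map]
  congr 1
  refine Matrix.list_prod_mul_intertwine _ _ _ _ fun k _ => ?_
  simp only [Function.comp_apply, Nat.succ_eq_add_one, Nat.add_sub_add_right]
  refine Matrix.list_prod_mul_intertwine _ _ _ _ fun a ha => ?_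
  have := List.mem_range.1 ha
  exact yMat_mul_inclInit (by omega) _

theorem yProd_mul_diagonal (s : ℕ) (c c' : ℕ → ℕ → 𝕂) (d : ℕ → 𝕂)
    (h : ∀ k a, k < s → a < s - k → c k a * d a = d (a + 1) * c' k a) :
    yProd s c * Matrix.diagonal (fun j : Fin (s + 1) => d j) =
      Matrix.diagonal (fun j : Fin (s + 1) => d j) * yProd s c' :=
  Matrix.list_prod_mul_intertwine _ _ _ _ fun k hk =>
    Matrix.list_prod_mul_intertwine _ _ _ _ fun a ha =>
      yMat_mul_diagonal d _ _ (h k a (List.mem_range.1 hk) (List.mem_range.1 ha))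

theorem exists_xProd_mul_w0bar_eq (s : ℕ) (q : ℕ → ℕ → 𝕂)
    (hq : ∀ k a, k < s → a < s - k → q k a ≠ 0) :
    ∃ B : Matrix (Fin (s + 1)) (Fin (s + 1)) 𝕂,
      (∀ a b : Fin (s + 1), b < a → B a b = 0) ∧ IsUnit B.det ∧
      xProd s q * w0bar (s + 1) 𝕂 = yProd s (idealInv s q) * B := by
  induction s generalizing q with
  | zero =>
    refine ⟨w0bar 1 𝕂, fun a b hab => absurd hab (by omega),
      isUnit_det_w0bar 1, by simp [xProd, yProd]⟩
  | succ s ih =>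
    obtain ⟨B', hB', -, hXY⟩ := ih (fun k => q (k + 1)) fun k a hk ha =>
      hq (k + 1) a (by omega) (by omega)
    set Y := yProd (s + 1) (idealInv (s + 1) q) with hY
    set D := Matrix.diagonal fun j : Fin (s + 1) => q 0 (s - j) with hD
    have hYu : IsUnit Y.det := by rw [hY, det_yProd]; exact isUnit_one
    have hcols : xProd (s + 1) q * w0bar (s + 2) 𝕂 * inclInit (s + 1) 𝕂 =
        Y * (inclInit (s + 1) 𝕂 * (D * B')) := by
      have hrow := prod_xMat_mul_inclTail (s + 1) (q 0) fun a ha => hq 0 a (by omega) ha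
      simp only [Nat.add_sub_cancel] at hrow
      have hdiag := yProd_mul_diagonal s (fun k => idealInv (s + 1) q (k + 1))
        (idealInv s fun k => q (k + 1)) (fun j => q 0 (s - j))
        fun k a hk ha => idealInv_succ s q k a (hq 0 _ (by omega) (by omega))
      rw [Matrix.mul_assoc, w0bar_mul_inclInit, ← Matrix.mul_assoc, xProd_succ_mul_inclTail,
        Matrix.mul_assoc, Matrix.mul_assoc, hXY, ← Matrix.mul_assoc, hrow, ← Matrix.mul_assoc Y,
        hY, yProd_succ_mul_inclInit]
      simp only [idealInv_zero, Nat.add_sub_cancel, Matrix.mul_assoc]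
      rw [← Matrix.mul_assoc (yProd s _) D, hdiag, Matrix.mul_assoc]
    refine ⟨Y⁻¹ * (xProd (s + 1) q * w0bar (s + 2) 𝕂), ?_, ?_, ?_⟩
    · have hBJ : Y⁻¹ * (xProd (s + 1) q * w0bar (s + 2) 𝕂) * inclInit (s + 1) 𝕂 =
          inclInit (s + 1) 𝕂 * (D * B') := by
        rw [Matrix.mul_assoc, hcols, Matrix.nonsing_inv_mul_cancel_left _ _ hYu]
      intro a b hab
      induction b using Fin.lastCases with
      | last => exact absurd hab (Fin.le_last a).not_gt
      | cast b =>
        have hab' := congrFun (congrFun hBJ a) b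
        rw [mul_inclInit, Matrix.submatrix_apply, id] at hab'
        rw [hab']
        induction a using Fin.lastCases with
        | last => exact inclInit_mul_last _ _
        | cast a =>
          rw [inclInit_mul_castSucc, hD, Matrix.diagonal_mul,
            hB' a b (Fin.castSucc_lt_castSucc_iff.1 hab), mul_zero]
    · rw [Matrix.det_mul, Matrix.det_mul, det_xProd, one_mul]
      exact (Matrix.isUnit_nonsing_inv_det _ hYu).mul (isUnit_det_w0bar _)
    · rw [Matrix.mul_nonsing_inv_cancel_left _ _ hYu]

end Triangular

theorem sIdx_succ_eq_sum_range (n k : ℕ) :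
    sIdx n (k + 1) = ∑ j ∈ Finset.range k, (n - 1 - j) := by
  rw [sIdx, Nat.add_sub_cancel, Finset.range_eq_Ico,
    Finset.sum_Ico_add' (fun j => n - j) 0 k 1 |>.symm.trans
      (Finset.sum_congr rfl fun j _ => by omega) |>.symm]
  rfl

theorem sum_range_sub_eq (s : ℕ) : ∑ j ∈ Finset.range s, (s - j) = (s + 1) * s / 2 := by
  have h := (Finset.sum_flip (n := s) fun j => j).trans (Finset.sum_range_id (s + 1))
  rwa [Finset.sum_range_succ, Nat.sub_self, add_zero, Nat.add_sub_cancel] at h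

/-- for u₁ = x_{i′_1}(p_1)⋯x_{i′_N}(p_N) and the ideal coordinates m
defined from the p's, there is an invertible upper triangular matrix B with
u₁·w̄₀ = y_{i_1}(m_1⁻¹)⋯y_{i_N}(m_N⁻¹)·B along the word 𝐢₀. -/
theorem stmt8
    (𝕂 : Type*) [Field 𝕂]
    (n N : ℕ) (hn : 2 ≤ n) (hN : N = n * (n - 1) / 2)
    (p : ℕ → 𝕂) (hp : ∀ j, 1 ≤ j → j ≤ N → p j ≠ 0)
    (u₁ : Matrix (Fin n) (Fin n) 𝕂)
    (hu₁ : u₁ = ((List.range N).map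
      (fun t => xMat n 𝕂 ((wordI0' n).getD t 0) (p (t + 1)))).prod)
    (m : ℕ → 𝕂)
    (hm : ∀ k a, 1 ≤ k → k ≤ n - 1 → 1 ≤ a → a ≤ n - k →
      m (sIdx n k + a) =
        (∏ r ∈ Finset.Icc 1 k, p (sIdx n (r + 1) - a + 1)) /
        (∏ r ∈ Finset.Icc 1 (k - 1), p (sIdx n (r + 1) - a))) :
    ∃ B : Matrix (Fin n) (Fin n) 𝕂,
      (∀ a b : Fin n, b < a → B a b = 0) ∧ IsUnit B.det ∧
      u₁ * w0bar n 𝕂 =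
        ((List.range N).map
          (fun t => yMat n 𝕂 ((wordI0 n).getD t 0) (m (t + 1))⁻¹)).prod * B := by
  obtain ⟨s, rfl⟩ : ∃ s, n = s + 1 := ⟨n - 1, by omega⟩
  have hNs : N = ∑ j ∈ Finset.range s, (s - j) := by
    rw [hN, sum_range_sub_eq, Nat.add_sub_cancel]
  have hS : ∀ k, sIdx (s + 1) (k + 1) = ∑ j ∈ Finset.range k, (s - j) :=
    fun k => sIdx_succ_eq_sum_range (s + 1) k
  have hS' : ∀ k, sIdx (s + 1) (k + 2) = sIdx (s + 1) (k + 1) + (s - k) := fun k => by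
    rw [hS k, hS (k + 1), Finset.sum_range_succ]
  have hSN : ∀ k, k < s → sIdx (s + 1) (k + 2) ≤ N := fun k hk => by
    rw [hS (k + 1), hNs]
    exact Finset.sum_le_sum_of_subset (Finset.range_subset_range.2 hk)
  set q : ℕ → ℕ → 𝕂 := fun k a => p (sIdx (s + 1) (k + 1) + a + 1) with hqdef
  have hX : u₁ = xProd s q := by
    rw [hu₁, hNs]
    refine (List.prod_map_range_getD_flatMap (fun i t => xMat (s + 1) 𝕂 i (p (t + 1)))
      (fun k => s - k) (fun _ a => s - a) s).trans ?_
    simp only [xProd, hqdef, hS]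
  have hY : ((List.range N).map fun t =>
      yMat (s + 1) 𝕂 ((wordI0 (s + 1)).getD t 0) (m (t + 1))⁻¹).prod =
      yProd s (idealInv s q) := by
    rw [hNs]
    refine (List.prod_map_range_getD_flatMap (fun i t => yMat (s + 1) 𝕂 i (m (t + 1))⁻¹)
      (fun k => s - k) (fun _ a => a + 1) s).trans ?_
    refine congrArg _ (List.map_congr_left fun k hk => congrArg _ (List.map_congr_left ?_))
    intro a ha
    have hk' := List.mem_range.1 hk
    have ha' := List.mem_range.1 ha
    rw [← hS k, add_assoc, hm (k + 1) (a + 1) (by omega) (by omega) (by omega) (by omega), inv_div,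
      idealInv, Nat.add_sub_cancel]
    have hI : ∀ (f : ℕ → 𝕂) l, ∏ r ∈ Finset.Icc 1 l, f r = ∏ r ∈ Finset.range l, f (r + 1) :=
      fun f l => by
        rw [Finset.range_eq_Ico, Finset.prod_Ico_add' f 0 l 1]
        rfl
    rw [hI, hI]
    congr 2
    · refine Finset.prod_congr rfl fun r hr => congrArg p ?_
      have hr' := Finset.mem_range.1 hr
      have := hS' r
      simp only [add_assoc, Nat.reduceAdd] at this ⊢
      omega
    · refine Finset.prod_congr rfl fun r hr => congrArg p ?_
      have hr' := Finset.mem_range.1 hr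
      have := hS' r
      simp only [add_assoc, Nat.reduceAdd] at this ⊢
      omega
  rw [hX, hY]
  refine exists_xProd_mul_w0bar_eq s q fun k a hk ha => hp _ (by omega) ?_
  have := hS' k
  have := hSN k hk
  omega
end

section
/- Let n ≥ 2 and N = n(n−1)/2. (1) For the word 𝐢₀ = (i_1,…,i_N), setting w_{(0)} := identity and w_{(k)} := s_{i_1}∘s_{i_2}∘⋯∘s_{i_k} ∈ S_n, for every 0 ≤ k ≤ N and 1 ≤ j ≤ n−1 the image set w_{(k)}({1,…,j}) is an interval of consecutive integers {a,…,b}. (2) For the word obtained by reversing 𝐢′₀, with w_{(k)} defined analogously from its letters, every image set w_{(k)}({1,…,j}) is the union of an initial segment {1,…,a} of {1,…,n} and a final segment {b,…,n} of {1,…,n} (either part possibly empty). -/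
open Matrix

theorem sPerm_apply_val {n i : ℕ} (h1 : 1 ≤ i) (h2 : i < n) (y : Fin n) :
    ((sPerm n i y : Fin n) : ℕ) =
      if (y : ℕ) + 1 = i then i else if (y : ℕ) = i then i - 1 else (y : ℕ) := by
  rw [sPerm, dif_pos ⟨h1, h2⟩, Equiv.swap_apply_def]
  simp only [Fin.ext_iff, apply_ite Fin.val]
  split_ifs <;> omega

/-- The product `s_{p+1} ∘ ⋯ ∘ s_{p+m}` is a cycle on the (0-based) positions `p, …, p+m`. -/
theorem prod_sPerm_range_apply_val {n p m : ℕ} (h : p + m < n) (y : Fin n) :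
    (((((List.range m).map (fun t => p + 1 + t)).map (sPerm n)).prod y : Fin n) : ℕ) =
      if (y : ℕ) < p then (y : ℕ) else if (y : ℕ) < p + m then (y : ℕ) + 1
      else if (y : ℕ) = p + m then p else (y : ℕ) := by
  induction m generalizing y with
  | zero => simp; split_ifs <;> omega
  | succ m ih =>
    rw [List.range_succ, List.map_append, List.map_append, List.prod_append, Equiv.Perm.mul_apply,
      ih (by omega)]
    simp only [List.map_cons, List.map_nil, List.prod_cons, List.prod_nil, mul_one]
    rw [sPerm_apply_val (by omega) (by omega)]
    split_ifs <;> omega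

theorem prod_range_map_sPerm_getD (n : ℕ) (l : List ℕ) (k : ℕ) :
    ((List.range k).map (fun t => sPerm n (l.getD t 0))).prod =
      ((l.take k).map (sPerm n)).prod := by
  induction k with
  | zero => simp
  | succ k ih =>
    rw [List.range_succ, List.map_append, List.prod_append, ih, List.take_add_one,
      List.map_append, List.prod_append]
    congr 1
    simp only [List.getD_eq_getElem?_getD]
    rcases h : l[k]? with _ | i <;> simp [sPerm, h]

/-- A prefix of a concatenation of blocks consists of full blocks and a prefix of the next one. -/
theorem exists_take_flatMap_range {α : Type*} (f : ℕ → List α) (R k : ℕ) (hR : 0 < R) :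
    ∃ r < R, ∃ m, ((List.range R).flatMap f).take k =
      (List.range r).flatMap f ++ (f r).take m := by
  induction R with
  | zero => omega
  | succ R ih =>
    rw [List.range_succ, List.flatMap_append, List.take_append]
    rcases le_or_gt k ((List.range R).flatMap f).length with hk | hk
    · rcases Nat.eq_zero_or_pos R with rfl | hR
      · exact ⟨0, by omega, 0, by simp at hk; simp [hk]⟩
      · obtain ⟨r, hr, m, hm⟩ := ih hR
        exact ⟨r, by omega, m, by rw [hm, Nat.sub_eq_zero_of_le hk]; simp⟩
    · exact ⟨R, by omega, _, by rw [List.take_of_length_le hk.le]; simp; rfl⟩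

theorem wordI0_eq (n : ℕ) : wordI0 n =
    (List.range (n - 1)).flatMap
      (fun r => (List.range (n - 1 - r)).map (fun t => 0 + 1 + t)) := by
  simp only [wordI0, zero_add, Nat.add_comm]

theorem reverse_flatMap_range {α : Type*} (f : ℕ → List α) (R : ℕ) :
    ((List.range R).flatMap f).reverse =
      (List.range R).flatMap (fun r => (f (R - 1 - r)).reverse) := by
  rw [List.reverse_flatMap, List.range_eq_range', List.reverse_range', List.flatMap_map,
    ← List.range_eq_range']
  refine List.flatMap_congr fun r _ => ?_
  simp

theorem reverse_wordI0' (n : ℕ) : (wordI0' n).reverse =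
    (List.range (n - 1)).flatMap
      (fun r => (List.range (r + 1)).map (fun t => n - 2 - r + 1 + t)) := by
  rw [wordI0', reverse_flatMap_range]
  refine List.flatMap_congr fun r hr => ?_
  rw [List.mem_range] at hr
  refine List.ext_getElem (by simp; omega) fun i h1 h2 => ?_
  simp at h1 h2 ⊢
  omega

theorem prod_wordI0_rows_apply_val {n r : ℕ} (hr : r < n) (y : Fin n) :
    ((((((List.range r).flatMap
      (fun r => (List.range (n - 1 - r)).map (fun t => 0 + 1 + t))).map (sPerm n)).prod y
        : Fin n)) : ℕ) = if (y : ℕ) < n - r then (y : ℕ) + r else n - 1 - (y : ℕ) := by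
  induction r generalizing y with
  | zero => simp
  | succ r ih =>
    rw [List.range_succ, List.flatMap_append, List.map_append, List.prod_append,
      Equiv.Perm.mul_apply, ih (by omega), List.flatMap_singleton,
      prod_sPerm_range_apply_val (by omega)]
    split_ifs <;> omega

theorem prod_reverse_wordI0'_rows_apply_val {n r : ℕ} (hr : r < n) (y : Fin n) :
    ((((((List.range r).flatMap
      (fun r => (List.range (r + 1)).map (fun t => n - 2 - r + 1 + t))).map (sPerm n)).prod y
        : Fin n)) : ℕ) =
      if (y : ℕ) < n - r - 1 then (y : ℕ) else 2 * n - 2 - r - (y : ℕ) := by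
  induction r generalizing y with
  | zero => simp; omega
  | succ r ih =>
    rw [List.range_succ, List.flatMap_append, List.map_append, List.prod_append,
      Equiv.Perm.mul_apply, ih (by omega), List.flatMap_singleton,
      prod_sPerm_range_apply_val (by omega)]
    split_ifs <;> omega

theorem exists_lt_apply_eq_iff {n j : ℕ} (σ : Equiv.Perm (Fin n)) {P : ℕ → Prop}
    (h : ∀ y : Fin n, (y : ℕ) < j ↔ P (σ y : ℕ)) (x : Fin n) :
    (∃ y : Fin n, (y : ℕ) < j ∧ σ y = x) ↔ P x := by
  obtain ⟨y, rfl⟩ := σ.surjective x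
  simp [h]

/-- (1) for the word 𝐢₀, every image w_{(k)}({1,…,j}) of an initial segment
under a partial product of simple reflections is an interval of consecutive integers;
(2) for the reverse of 𝐢′₀, every such image is the union of an initial segment and a
final segment of {1,…,n}. (All labels 1-based; `Fin n` is 0-based, so the label of
`x : Fin n` is `(x : ℕ) + 1`.) -/
theorem stmt9 (n N : ℕ) (hn : 2 ≤ n) (hN : N = n * (n - 1) / 2) :
    (∀ k, k ≤ N → ∀ j, 1 ≤ j → j ≤ n - 1 →
      ∃ a : ℕ, ∀ x : Fin n,
        ((∃ y : Fin n, (y : ℕ) < j ∧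
            (((List.range k).map (fun t => sPerm n ((wordI0 n).getD t 0))).prod) y = x) ↔
          (a ≤ (x : ℕ) + 1 ∧ (x : ℕ) + 1 < a + j))) ∧
    (∀ k, k ≤ N → ∀ j, 1 ≤ j → j ≤ n - 1 →
      ∃ a b : ℕ, ∀ x : Fin n,
        ((∃ y : Fin n, (y : ℕ) < j ∧
            (((List.range k).map
              (fun t => sPerm n (((wordI0' n).reverse).getD t 0))).prod) y = x) ↔
          ((x : ℕ) + 1 ≤ a ∨ b ≤ (x : ℕ) + 1))) := by
  refine ⟨fun k _ j hj1 hj2 => ?_, fun k _ j hj1 hj2 => ?_⟩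
  · rw [prod_range_map_sPerm_getD, wordI0_eq]
    obtain ⟨r, hr, m, hm⟩ := exists_take_flatMap_range
      (fun r => (List.range (n - 1 - r)).map (fun t => 0 + 1 + t)) (n - 1) k (by omega)
    rw [hm, List.map_append, List.prod_append, ← List.map_take, List.take_range]
    set q := min m (n - 1 - r)
    have hq : q ≤ n - 1 - r := min_le_right _ _
    refine ⟨if j ≤ q then r + 2 else if j ≤ n - r then r + 1 else n - j + 1,
      exists_lt_apply_eq_iff (P := fun x => _ ≤ x + 1 ∧ x + 1 < _ + j) _ fun y => ?_⟩
    rw [Equiv.Perm.mul_apply, prod_wordI0_rows_apply_val (by omega),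
      prod_sPerm_range_apply_val (by omega)]
    split_ifs <;> omega
  · rw [prod_range_map_sPerm_getD, reverse_wordI0']
    obtain ⟨r, hr, m, hm⟩ := exists_take_flatMap_range
      (fun r => (List.range (r + 1)).map (fun t => n - 2 - r + 1 + t)) (n - 1) k (by omega)
    rw [hm, List.map_append, List.prod_append, ← List.map_take, List.take_range]
    set q := min m (r + 1)
    have hq : q ≤ r + 1 := min_le_right _ _
    refine ⟨if j ≤ n - 2 - r then j else if j ≤ n - 2 - r + q then n - 2 - r else n - 1 - r,
      if j ≤ n - 2 - r then n + 1 else if j ≤ n - 2 - r + q then n + 1 - (j - (n - 2 - r))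
        else n + 1 - (j - (n - 1 - r)),
      exists_lt_apply_eq_iff (P := fun x => x + 1 ≤ _ ∨ _ ≤ x + 1) _ fun y => ?_⟩
    rw [Equiv.Perm.mul_apply, prod_reverse_wordI0'_rows_apply_val (by omega),
      prod_sPerm_range_apply_val (by omega)]
    split_ifs <;> omega
end

section
/- Let 𝕂 be a field, n ≥ 2, N = n(n−1)/2, p = (p_1,…,p_N) ∈ (𝕂ˣ)^N, and u₁ := x_{i′_1}(p_1)·x_{i′_2}(p_2)⋯x_{i′_N}(p_N) with (i′_1,…,i′_N) = 𝐢′₀. Then for all integers k ≥ 1 and a ≥ 1 with k + a ≤ n, the minor of u₁ with row set {1,…,a} and column set {k+1,…,k+a} equals ∏_{r=1}^{k} ∏_{b=1}^{a} p_{s_{r+1}−b+1}. -/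
open Matrix

/-- The upper bidiagonal unipotent matrix whose (0-based) entry `(j, j + 1)` is `d j`. -/
def upperBidiag {𝕂 : Type*} [Field 𝕂] (n : ℕ) (d : ℕ → 𝕂) : Matrix (Fin n) (Fin n) 𝕂 :=
  fun i j => if i = j then 1 else if (i : ℕ) + 1 = j then d i else 0

section UpperBidiag

variable {𝕂 : Type*} [Field 𝕂] {n : ℕ}

theorem mul_upperBidiag_apply_zero {m : Type*} (M : Matrix m (Fin n) 𝕂) (d : ℕ → 𝕂) (i : m)
    (h : 0 < n) : (M * upperBidiag n d) i ⟨0, h⟩ = M i ⟨0, h⟩ := by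
  rw [Matrix.mul_apply, Finset.sum_eq_single ⟨0, h⟩]
  · simp [upperBidiag]
  · intro j _ hj
    simp [upperBidiag, hj]
  · simp

theorem mul_upperBidiag_apply_succ {m : Type*} (M : Matrix m (Fin n) 𝕂) (d : ℕ → 𝕂) (i : m)
    (l : ℕ) (h : l + 1 < n) :
    (M * upperBidiag n d) i ⟨l + 1, h⟩ = M i ⟨l + 1, h⟩ + M i ⟨l, by omega⟩ * d l := by
  rw [Matrix.mul_apply, Finset.sum_eq_add (⟨l + 1, h⟩ : Fin n) ⟨l, by omega⟩]
  · simp [upperBidiag]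
  · simp
  · rintro j - ⟨h1, h2⟩
    have h3 : (j : ℕ) ≠ l := fun e => h2 (Fin.ext e)
    simp [upperBidiag, h1, h3]
  · simp
  · simp

theorem upperBidiag_mul_upperBidiag (d e : ℕ → 𝕂) (h : ∀ j, d j * e (j + 1) = 0) :
    upperBidiag n d * upperBidiag n e = upperBidiag n (d + e) := by
  ext i ⟨l, hl⟩
  cases l with
  | zero => simp [mul_upperBidiag_apply_zero, upperBidiag]
  | succ l =>
    rw [mul_upperBidiag_apply_succ]
    have := h i
    simp only [upperBidiag, Fin.ext_iff, Pi.add_apply]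
    grind

theorem upperBidiag_zero : upperBidiag n (0 : ℕ → 𝕂) = 1 := by
  ext i j
  simp [upperBidiag, Matrix.one_apply]

theorem det_upperBidiag (d : ℕ → 𝕂) : (upperBidiag n d).det = 1 := by
  rw [Matrix.det_of_isUpperTriangular]
  · simp [upperBidiag]
  · intro i j hij
    have h : (j : ℕ) < i := hij
    simp only [upperBidiag, Fin.ext_iff]
    rw [if_neg (by omega), if_neg (by omega)]

theorem submatrix_mul_upperBidiag {m : Type*} (M : Matrix m (Fin n) 𝕂) (d : ℕ → 𝕂) {k a : ℕ}
    (hka : k + a ≤ n) (hd : ∀ j < k, d j = 0) :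
    (M * upperBidiag n d).submatrix id
        (fun t : Fin a => (⟨k + (t : ℕ), by have := t.isLt; omega⟩ : Fin n)) =
      M.submatrix id (fun t : Fin a => (⟨k + (t : ℕ), by have := t.isLt; omega⟩ : Fin n)) *
        upperBidiag a (fun t => d (k + t)) := by
  ext i ⟨l, hl⟩
  cases l with
  | zero =>
    rw [mul_upperBidiag_apply_zero]
    cases k with
    | zero => simp [mul_upperBidiag_apply_zero]
    | succ k => simp [mul_upperBidiag_apply_succ, hd k]
  | succ l =>
    rw [mul_upperBidiag_apply_succ]
    exact mul_upperBidiag_apply_succ M d i (k + l) (by omega)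

theorem xMat_eq_upperBidiag (i : ℕ) (z : 𝕂) :
    xMat n 𝕂 i z = upperBidiag n (fun j => if j + 1 = i then z else 0) := by
  ext a b
  simp only [xMat, upperBidiag]
  grind

/-- A product of `x_i` with strictly decreasing indices `n - 1, n - 2, …` is bidiagonal. -/
theorem prod_xMat_descending (z : ℕ → 𝕂) (c : ℕ) (hc : c ≤ n - 1) :
    ((List.range c).map (fun t => xMat n 𝕂 (n - 1 - t) (z t))).prod =
      upperBidiag n (fun j => if n - 1 - c ≤ j ∧ j + 1 < n then z (n - 2 - j) else 0) := by
  induction c with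
  | zero =>
    rw [List.range_zero, List.map_nil, List.prod_nil, ← upperBidiag_zero]
    congr 1
    ext j
    rw [if_neg (by omega), Pi.zero_apply]
  | succ c ih =>
    rw [List.range_succ, List.map_append, List.prod_append, ih (by omega), List.map_singleton,
      List.prod_singleton, xMat_eq_upperBidiag, upperBidiag_mul_upperBidiag]
    · congr 1
      ext j
      simp only [Pi.add_apply]
      by_cases h : j + 1 = n - 1 - c
      · rw [if_neg (by omega), if_pos h, if_pos (by omega), zero_add]
        congr 1
        omega
      · rw [if_neg h, add_zero]
        congr 1
        simp only [eq_iff_iff]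
        omega
    · intro j
      by_cases h : j + 1 + 1 = n - 1 - c
      · rw [if_neg (by omega), zero_mul]
      · rw [if_neg h, mul_zero]

theorem prod_upperBidiag_apply_eq_zero (d : ℕ → ℕ → 𝕂) (m : ℕ) (i l : Fin n)
    (h : (i : ℕ) + m < l) :
    ((List.range m).map (fun r => upperBidiag n (d r))).prod i l = 0 := by
  induction m generalizing l with
  | zero =>
    have : i ≠ l := by rintro rfl; omega
    simp [this]
  | succ m ih =>
    obtain ⟨l, hl⟩ := l
    obtain ⟨l, rfl⟩ : ∃ l', l = l' + 1 := ⟨l - 1, by simp only at h; omega⟩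
    simp only at h
    rw [List.range_succ, List.map_append, List.prod_append, List.map_singleton,
      List.prod_singleton, mul_upperBidiag_apply_succ, ih _ (by simp only; omega),
      ih _ (by simp only; omega)]
    simp

theorem prod_upperBidiag_apply_add (d : ℕ → ℕ → 𝕂) (m : ℕ) (i : Fin n) (h : (i : ℕ) + m < n) :
    ((List.range m).map (fun r => upperBidiag n (d r))).prod i ⟨i + m, h⟩ =
      ∏ r ∈ Finset.range m, d r (i + r) := by
  induction m with
  | zero => simp
  | succ m ih =>
    rw [List.range_succ, List.map_append, List.prod_append, List.map_singleton,
      List.prod_singleton, Finset.prod_range_succ, ← ih (by omega)]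
    refine (mul_upperBidiag_apply_succ _ _ i (i + m) h).trans ?_
    rw [prod_upperBidiag_apply_eq_zero _ _ _ _ (by simp only; omega), zero_add]

theorem det_submatrix_prod_upperBidiag (d : ℕ → ℕ → 𝕂) {k a m : ℕ} (hka : k + a ≤ n)
    (hd : ∀ r, ∀ j < r, d r j = 0) (hm : k ≤ m) :
    (((List.range m).map (fun r => upperBidiag n (d r))).prod.submatrix
        (fun t : Fin a => (⟨(t : ℕ), by have := t.isLt; omega⟩ : Fin n))
        (fun t : Fin a => (⟨k + (t : ℕ), by have := t.isLt; omega⟩ : Fin n))).det =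
      ∏ r ∈ Finset.range k, ∏ t ∈ Finset.range a, d r (t + r) := by
  induction m, hm using Nat.le_induction with
  | base =>
    rw [Matrix.det_of_isLowerTriangular, Finset.prod_comm, ← Fin.prod_univ_eq_prod_range
      (fun t => ∏ r ∈ Finset.range k, d r (t + r))]
    · refine Finset.prod_congr rfl fun t _ => ?_
      rw [← prod_upperBidiag_apply_add (n := n) d k ⟨t, by omega⟩ (by simp only; omega)]
      simp [add_comm]
    · intro i j hij
      have h : (i : ℕ) < j := hij
      exact prod_upperBidiag_apply_eq_zero _ _ _ _ (by simp only; omega)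
  | succ m hm ih =>
    rw [List.range_succ, List.map_append, List.prod_append, List.map_singleton,
      List.prod_singleton, ← ih]
    have h := congrArg (fun M => (M.submatrix
      (fun t : Fin a => (⟨(t : ℕ), by have := t.isLt; omega⟩ : Fin n)) id).det)
      (submatrix_mul_upperBidiag ((List.range m).map (fun r => upperBidiag n (d r))).prod (d m)
        hka (fun j hj => hd m j (by omega)))
    simp only [Matrix.submatrix_submatrix, Function.id_comp, Function.comp_id] at h
    rw [h, Matrix.submatrix_mul _ _ _ id _ Function.bijective_id, Matrix.det_mul,
      Matrix.submatrix_id_id, det_upperBidiag, mul_one]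
    rfl

end UpperBidiag

theorem length_flatMap_range_map {α : Type*} (c : ℕ → ℕ) (f : ℕ → ℕ → α) (M : ℕ) :
    ((List.range M).flatMap (fun k => (List.range (c k)).map (f k))).length =
      ∑ k ∈ Finset.range M, c k := by
  induction M with
  | zero => simp
  | succ M ih =>
    rw [List.range_succ, List.flatMap_append, List.length_append, ih, Finset.sum_range_succ]
    simp

theorem getD_flatMap_range_map {α : Type*} (c : ℕ → ℕ) (f : ℕ → ℕ → α) (x : α) {M m t : ℕ}
    (hm : m < M) (ht : t < c m) :
    ((List.range M).flatMap (fun k => (List.range (c k)).map (f k))).getD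
      (∑ k ∈ Finset.range m, c k + t) x = f m t := by
  induction M with
  | zero => omega
  | succ M ih =>
    rw [List.range_succ, List.flatMap_append]
    rcases Nat.lt_succ_iff_lt_or_eq.mp hm with h | rfl
    · rw [List.getD_append, ih h]
      rw [length_flatMap_range_map]
      calc _ < ∑ k ∈ Finset.range (m + 1), c k := by rw [Finset.sum_range_succ]; omega
        _ ≤ _ := Finset.sum_le_sum_of_subset (Finset.range_mono h)
    · rw [List.getD_append_right _ _ _ _ (by rw [length_flatMap_range_map]; omega),
        length_flatMap_range_map]
      simp [ht]

theorem sIdx_succ (n r : ℕ) : sIdx n (r + 1) = ∑ k ∈ Finset.range r, (n - 1 - k) := by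
  rw [sIdx, Nat.add_sub_cancel, ← Finset.Ico_add_one_right_eq_Icc,
    Finset.sum_Ico_eq_sum_range, Nat.add_sub_cancel]
  exact Finset.sum_congr rfl fun k _ => by omega

theorem prod_xMat_wordI0' {𝕂 : Type*} [Field 𝕂] (n : ℕ) (p : ℕ → 𝕂) (m : ℕ) (hm : m ≤ n - 1) :
    ((List.range (sIdx n (m + 1))).map
      (fun t => xMat n 𝕂 ((wordI0' n).getD t 0) (p (t + 1)))).prod =
    ((List.range m).map (fun r => upperBidiag n
      (fun j => if r ≤ j ∧ j + 1 < n then p (sIdx n (r + 1) + (n - 2 - j) + 1) else 0))).prod := by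
  induction m with
  | zero => simp [sIdx]
  | succ m ih =>
    have hs : sIdx n (m + 1 + 1) = sIdx n (m + 1) + (n - 1 - m) := by
      rw [sIdx_succ, sIdx_succ, Finset.sum_range_succ]
    rw [hs, List.range_add, List.map_append, List.prod_append, ih (by omega), List.range_succ,
      List.map_append, List.prod_append, List.map_singleton, List.prod_singleton]
    congr 1
    have h := prod_xMat_descending (n := n) (fun t => p (sIdx n (m + 1) + t + 1)) (n - 1 - m)
      (by omega)
    rw [show n - 1 - (n - 1 - m) = m by omega] at h
    rw [← h, List.map_map]
    congr 1
    refine List.map_congr_left fun t ht => ?_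
    rw [List.mem_range] at ht
    simp only [Function.comp_apply]
    congr 1
    rw [sIdx_succ]
    exact getD_flatMap_range_map _ (fun _ t => n - 1 - t) 0 (by omega) ht

theorem sIdx_self (n : ℕ) : sIdx n (n - 1 + 1) = n * (n - 1) / 2 := by
  rw [sIdx_succ, ← Finset.sum_range_id, ← Finset.sum_range_reflect (fun i => i) n]
  rcases n with _ | n
  · rfl
  · rw [Finset.sum_range_succ]
    simp

/-- the minor of u₁ = x_{i′_1}(p_1)⋯x_{i′_N}(p_N) with row set {1,…,a}
and column set {k+1,…,k+a} equals ∏_{r=1}^{k} ∏_{b=1}^{a} p_{s_{r+1}−b+1}. -/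
theorem stmt10
    (𝕂 : Type*) [Field 𝕂]
    (n N : ℕ) (hn : 2 ≤ n) (hN : N = n * (n - 1) / 2)
    (p : ℕ → 𝕂) (hp : ∀ j, 1 ≤ j → j ≤ N → p j ≠ 0)
    (u₁ : Matrix (Fin n) (Fin n) 𝕂)
    (hu₁ : u₁ = ((List.range N).map
      (fun t => xMat n 𝕂 ((wordI0' n).getD t 0) (p (t + 1)))).prod)
    (k a : ℕ) (hk : 1 ≤ k) (ha : 1 ≤ a) (hka : k + a ≤ n) :
    (u₁.submatrix
        (fun t : Fin a => (⟨(t : ℕ), by have := t.isLt; omega⟩ : Fin n))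
        (fun t : Fin a => (⟨k + (t : ℕ), by have := t.isLt; omega⟩ : Fin n))).det =
      ∏ r ∈ Finset.Icc 1 k, ∏ b ∈ Finset.Icc 1 a, p (sIdx n (r + 1) - b + 1) := by
  subst hN hu₁
  rw [← sIdx_self, prod_xMat_wordI0' n p (n - 1) le_rfl,
    det_submatrix_prod_upperBidiag _ hka (fun r j hj => if_neg (by omega)) (by omega),
    ← Finset.Ico_add_one_right_eq_Icc, Finset.prod_Ico_eq_prod_range, Nat.add_sub_cancel]
  refine Finset.prod_congr rfl fun r hr => ?_
  rw [← Finset.Ico_add_one_right_eq_Icc, Finset.prod_Ico_eq_prod_range, Nat.add_sub_cancel]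
  refine Finset.prod_congr rfl fun t ht => ?_
  rw [Finset.mem_range] at hr ht
  rw [if_pos (by omega), add_comm 1 r, sIdx_succ n (r + 1), Finset.sum_range_succ, ← sIdx_succ]
  congr 1
  omega
end

section
/- Let 𝕂 be a field, n ≥ 2, N = n(n−1)/2, and m = (m_1,…,m_N) ∈ (𝕂ˣ)^N. Suppose r assigns a value in 𝕂ˣ to each arrow of the Givental quiver such that: (i) on vertical arrows, r(a_{ij}) = (∏_{t=0}^{j−1} m_{s_{j−t}+i−j+1+t}) / (∏_{t=0}^{j−2} m_{s_{j−1−t}+i−j+1+t}) for all 1 ≤ j ≤ i ≤ n−1 (empty products equal 1); (ii) the box relations r(a_{ij})·r(b_{i+1,j+1}) = r(b_{i,j+1})·r(a_{i,j+1}) hold whenever all four of these arrows exist; (iii) at every dot vertex v, Σ_{a : h(a)=v} r(a) = Σ_{a : t(a)=v} r(a). Then for every dot vertex v_{ik} (1 ≤ k < i ≤ n), the sum of r over the arrows with tail v_{ik} equals m_{s_k + i − k}. -/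
open Matrix

/-- The monomials prescribed on horizontally adjacent vertical arrows have ratio
`m (sIdx n (k + 1) + (i - k)) / m (sIdx n k + (i - k))`. -/
theorem vertical_monomial_ratio {𝕂 : Type*} [Field 𝕂] (n : ℕ) (m : ℕ → 𝕂) (rA : ℕ → ℕ → 𝕂)
    (hrA0 : ∀ i j, 1 ≤ j → j ≤ i → i ≤ n - 1 → rA i j ≠ 0)
    (hvert : ∀ i j, 1 ≤ j → j ≤ i → i ≤ n - 1 →
      rA i j =
        (∏ t ∈ Finset.range j, m (sIdx n (j - t) + (i - j + 1 + t))) /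
        (∏ t ∈ Finset.range (j - 1), m (sIdx n (j - 1 - t) + (i - j + 1 + t))))
    {i k : ℕ} (hk : 1 ≤ k) (hki : k + 1 ≤ i) (hi : i ≤ n - 1) :
    rA i (k + 1) * m (sIdx n k + (i - k)) = rA i k * m (sIdx n (k + 1) + (i - k)) := by
  obtain ⟨k, rfl⟩ := Nat.exists_eq_add_of_le' hk
  have hne := hrA0 i (k + 1 + 1) (by omega) hki hi
  rw [hvert i (k + 1 + 1) (by omega) hki hi] at hne ⊢
  rw [hvert i (k + 1) (by omega) (by omega) hi]
  have peel (j c : ℕ) : ∏ t ∈ Finset.range (j + 1), m (sIdx n (j + 1 - t) + (c + t)) =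
      (∏ t ∈ Finset.range j, m (sIdx n (j - t) + (c + 1 + t))) * m (sIdx n (j + 1) + c) := by
    simp [Finset.prod_range_succ', add_comm, add_left_comm]
  have index : i - (k + 1 + 1) + 1 = i - (k + 1) := by omega
  simp only [Nat.add_sub_cancel, index] at hne ⊢
  rw [peel (k + 1), peel k (i - (k + 1))] at hne ⊢
  have hden := (div_ne_zero_iff.mp hne).2
  have hprod := left_ne_zero_of_mul hden
  have hlast := right_ne_zero_of_mul hden
  field_simp

/-- in the Givental quiver, if the vertical arrow coordinates are the
given monomials in the m's, the box relations hold, and the critical point conditions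
hold at every dot vertex, then the sum of the coordinates of the outgoing arrows at
each dot vertex v_{ik} equals m_{s_k+i−k}.  Here `rA i j` is the coordinate of the
vertical arrow a_{ij} (1 ≤ j ≤ i ≤ n−1) and `rB i j` that of the horizontal arrow
b_{ij} (2 ≤ j ≤ i ≤ n). -/
theorem stmt12
    (𝕂 : Type*) [Field 𝕂]
    (n N : ℕ) (hn : 2 ≤ n) (hN : N = n * (n - 1) / 2)
    (m : ℕ → 𝕂) (hm : ∀ j, 1 ≤ j → j ≤ N → m j ≠ 0)
    (rA rB : ℕ → ℕ → 𝕂)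
    (hrA0 : ∀ i j, 1 ≤ j → j ≤ i → i ≤ n - 1 → rA i j ≠ 0)
    (hrB0 : ∀ i j, 2 ≤ j → j ≤ i → i ≤ n → rB i j ≠ 0)
    (hvert : ∀ i j, 1 ≤ j → j ≤ i → i ≤ n - 1 →
      rA i j =
        (∏ t ∈ Finset.range j, m (sIdx n (j - t) + (i - j + 1 + t))) /
        (∏ t ∈ Finset.range (j - 1), m (sIdx n (j - 1 - t) + (i - j + 1 + t))))
    (hbox : ∀ i j, 1 ≤ j → j + 1 ≤ i → i ≤ n - 1 →
      rA i j * rB (i + 1) (j + 1) = rB i (j + 1) * rA i (j + 1))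
    (hcrit : ∀ i j, 1 ≤ j → j < i → i ≤ n →
      ((if i ≤ n - 1 then rA i j else 0) + rB i (j + 1)) =
      (rA (i - 1) j + if 2 ≤ j then rB i j else 0)) :
    ∀ i k, 1 ≤ k → k < i → i ≤ n →
      rA (i - 1) k + (if 2 ≤ k then rB i k else 0) = m (sIdx n k + (i - k)) := by
  intro i k hk
  induction k, hk using Nat.le_induction generalizing i with
  | base =>
    intro h1i hin
    rw [hvert (i - 1) 1 le_rfl (by omega) (by omega)]
    have index : i - 1 - 1 + 1 = i - 1 := by omega
    simp [index]
  | succ k hk ih =>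
    intro hki hin
    obtain ⟨i, rfl⟩ := Nat.exists_eq_add_of_le' (by omega : 1 ≤ i)
    have hin' : i ≤ n - 1 := by omega
    have hA := hrA0 i k hk (by omega) hin'
    have hratio := vertical_monomial_ratio n m rA hrA0 hvert hk (by omega) hin'
    have hb := hbox i k hk (by omega) hin'
    have hc := (hcrit i k hk (by omega) (by omega)).trans (ih i (by omega) (by omega))
    rw [if_pos hin'] at hc
    rw [if_pos (by omega), Nat.add_sub_cancel, Nat.add_sub_add_right]
    apply mul_left_cancel₀ hA
    linear_combination hb + rA i (k + 1) * hc + hratio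
end

section
/- Let n ≥ 2, λ = (λ_1 ≥ λ_2 ≥ … ≥ λ_n) ∈ ℝⁿ, ℓ := (1/n)Σ_i λ_i, and let {n_{ij}}_{1≤i<j≤n} be an ideal filling for λ. For 1 ≤ i ≤ j ≤ n set H^h_{ij} := Σ_{l > j} n_{il} and H^v_{ij} := Σ_{l < i} n_{lj}, and define δ on the vertices of the Givental quiver by δ_{v_{ji}} := H^h_{ij} − H^v_{ij} + ℓ (for 1 ≤ i ≤ j ≤ n). Then: (a) δ_{v_{kk}} = λ_k for every 1 ≤ k ≤ n; (b) setting ρ_a := δ_{h(a)} − δ_{t(a)} for each arrow a, ρ_a ≥ 0 for every arrow; and (c) the tropical critical point conditions hold at every dot vertex: min_{a : h(a)=v} ρ_a = min_{a : t(a)=v} ρ_a. -/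
open Matrix

/-- The max conditions defining an ideal filling of size `n` (1-based indices). -/
structure IsIdealFilling (n : ℕ) (f : ℕ → ℕ → ℝ) : Prop where
  nonneg : ∀ i j, 1 ≤ i → i < j → j ≤ n → 0 ≤ f i j
  eq_max : ∀ i j, 1 ≤ i → i < j → j ≤ n → 2 ≤ j - i → f i j = max (f (i + 1) j) (f i (j - 1))

/-- The value of `δ i j - δ (i + 1) j` in terms of the filling. -/
def verticalGap (f : ℕ → ℕ → ℝ) (j i : ℕ) : ℝ :=
  f j (i + 1) + ∑ l ∈ Finset.Icc 1 (j - 1), (f l (i + 1) - f l i)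

/-- The value of `δ i j - δ i (j + 1)` in terms of the filling. -/
def horizontalGap (n : ℕ) (f : ℕ → ℕ → ℝ) (j i : ℕ) : ℝ :=
  f j i + ∑ l ∈ Finset.Icc (i + 1) n, (f j l - f (j + 1) l)

/-- The expression `H^h_{ji} - H^v_{ji}` attached to a filling. -/
def hookDiff (n : ℕ) (f : ℕ → ℕ → ℝ) (j i : ℕ) : ℝ :=
  (∑ l ∈ Finset.Icc (i + 1) n, f j l) - ∑ l ∈ Finset.Icc 1 (j - 1), f l i

theorem hookDiff_sub_succ_right {n : ℕ} (f : ℕ → ℕ → ℝ) {j i : ℕ} (hi : i < n) :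
    hookDiff n f j i - hookDiff n f j (i + 1) = verticalGap f j i := by
  have h : Finset.Icc (i + 1) n = insert (i + 1) (Finset.Icc (i + 1 + 1) n) := by
    ext; simp; omega
  rw [hookDiff, hookDiff, verticalGap, h, Finset.sum_insert (by simp), Finset.sum_sub_distrib]
  ring

theorem hookDiff_sub_succ_left (n : ℕ) (f : ℕ → ℕ → ℝ) {j : ℕ} (i : ℕ) (hj : 1 ≤ j) :
    hookDiff n f j i - hookDiff n f (j + 1) i = horizontalGap n f j i := by
  have h : Finset.Icc 1 (j + 1 - 1) = insert j (Finset.Icc 1 (j - 1)) := by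
    ext; simp; omega
  rw [hookDiff, hookDiff, horizontalGap, h, Finset.sum_insert (by simp; omega),
    Finset.sum_sub_distrib]
  ring

theorem verticalGap_eq {f : ℕ → ℕ → ℝ} {j i : ℕ}
    (h : ∀ l, 1 ≤ l → l < j → f l (i + 1) = f l i) : verticalGap f j i = f j (i + 1) := by
  rw [verticalGap, Finset.sum_eq_zero, add_zero]
  intro l hl
  rw [Finset.mem_Icc] at hl
  rw [h l hl.1 (by omega), sub_self]

theorem horizontalGap_eq {n : ℕ} {f : ℕ → ℕ → ℝ} {j i : ℕ}
    (h : ∀ l, i < l → l ≤ n → f j l = f (j + 1) l) : horizontalGap n f j i = f j i := by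
  rw [horizontalGap, Finset.sum_eq_zero, add_zero]
  intro l hl
  rw [Finset.mem_Icc] at hl
  rw [h l (by omega) hl.2, sub_self]

namespace IsIdealFilling

variable {n : ℕ} {f : ℕ → ℕ → ℝ}

theorem succ_eq_max (hf : IsIdealFilling n f) {i j : ℕ} (hi : 1 ≤ i) (hij : i < j)
    (hj : j < n) : f i (j + 1) = max (f (i + 1) (j + 1)) (f i j) :=
  hf.eq_max i (j + 1) hi (by omega) hj (by omega)

theorem le_succ_right (hf : IsIdealFilling n f) {i j : ℕ} (hi : 1 ≤ i) (hij : i < j)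
    (hj : j < n) : f i j ≤ f i (j + 1) :=
  hf.succ_eq_max hi hij hj ▸ le_max_right _ _

theorem succ_left_le (hf : IsIdealFilling n f) {i j : ℕ} (hi : 1 ≤ i) (hij : i + 1 < j)
    (hj : j ≤ n) : f (i + 1) j ≤ f i j := by
  rw [hf.eq_max i j hi (by omega) hj (by omega)]
  exact le_max_left _ _

/-- Once two consecutive rows agree, they agree further to the right. -/
theorem rows_agree (hf : IsIdealFilling n f) {i b : ℕ} (hi : 1 ≤ i) (hib : i + 1 < b)
    (h : f i b = f (i + 1) b) {l : ℕ} (hbl : b ≤ l) (hl : l ≤ n) :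
    f i l = f (i + 1) l := by
  induction l, hbl using Nat.le_induction with
  | base => exact h
  | succ l hbl ih =>
    rw [hf.succ_eq_max hi (by omega) hl, ih (by omega)]
    exact max_eq_left (hf.le_succ_right (by omega) (by omega) hl)

/-- Once two consecutive columns agree, they agree further up. -/
theorem columns_agree (hf : IsIdealFilling n f) {a b : ℕ} (hab : a < b) (hb : b < n)
    (h : f a (b + 1) = f a b) {l : ℕ} (hl : 1 ≤ l) (hla : l ≤ a) :
    f l (b + 1) = f l b := by
  induction hla using Nat.decreasingInduction with
  | self => exact h
  | of_succ l hla ih =>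
    rw [hf.succ_eq_max hl (by omega) hb, ih (by omega)]
    exact max_eq_right (hf.succ_left_le hl (by omega) hb.le)

theorem le_verticalGap (hf : IsIdealFilling n f) {j i : ℕ} (hji : j ≤ i) (hi : i < n) :
    f j (i + 1) ≤ verticalGap f j i := by
  refine le_add_of_nonneg_right (Finset.sum_nonneg fun l hl => ?_)
  rw [Finset.mem_Icc] at hl
  exact sub_nonneg.2 (hf.le_succ_right hl.1 (by omega) hi)

theorem le_horizontalGap (hf : IsIdealFilling n f) {j i : ℕ} (hj : 1 ≤ j) (hji : j < i) :
    f j i ≤ horizontalGap n f j i := by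
  refine le_add_of_nonneg_right (Finset.sum_nonneg fun l hl => ?_)
  rw [Finset.mem_Icc] at hl
  exact sub_nonneg.2 (hf.succ_left_le hj (by omega) hl.2)

theorem min_incoming (hf : IsIdealFilling n f) {j i : ℕ} (hj : 1 ≤ j) (hji : j < i)
    (hi : i < n) : min (verticalGap f j i) (horizontalGap n f j i) = f j i := by
  have hV := (hf.le_succ_right hj hji hi).trans (hf.le_verticalGap hji.le hi)
  have hH := hf.le_horizontalGap hj hji
  rcases max_choice (f (j + 1) (i + 1)) (f j i) with h | h <;>
    rw [← hf.succ_eq_max hj hji hi] at h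
  · have := horizontalGap_eq fun l hl hln => hf.rows_agree hj (by omega) h (l := l) hl hln
    rw [this, min_eq_right hV]
  · have := verticalGap_eq fun l hl hlj => hf.columns_agree hji hi h hl (le_of_lt hlj)
    rw [this, h, min_eq_left (h ▸ hH)]

theorem min_outgoing (hf : IsIdealFilling n f) {j i : ℕ} (hj : 1 ≤ j) (hji : j < i)
    (hi : i < n) :
    min (verticalGap f (j + 1) i) (horizontalGap n f j (i + 1)) = f (j + 1) (i + 1) := by
  have hV := hf.le_verticalGap (j := j + 1) hji hi
  have hH := (hf.succ_left_le hj (by omega) hi).trans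
    (hf.le_horizontalGap hj (by omega : j < i + 1))
  rcases max_choice (f (j + 1) (i + 1)) (f j i) with h | h <;>
    rw [← hf.succ_eq_max hj hji hi] at h
  · have := horizontalGap_eq fun l (hl : i + 1 < l) hln =>
      hf.rows_agree hj (by omega) h (l := l) hl.le hln
    rw [this, h, min_eq_right hV]
  · have := verticalGap_eq fun l hl (hlj : l < j + 1) =>
      hf.columns_agree hji hi h hl (by omega)
    rw [this, min_eq_left hH]

end IsIdealFilling

/-- from an ideal filling for λ, the assignment
δ_{v_{ji}} := H^h_{ij} − H^v_{ij} + ℓ gives (a) δ_{v_{kk}} = λ_k at star vertices,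
(b) non-negative tropical arrow coordinates ρ_a = δ_{h(a)} − δ_{t(a)}, and
(c) a solution of the tropical critical point conditions at every dot vertex.
Here `δ r c` is the value at the vertex v_{rc} (row r, column c). -/
theorem stmt15
    (n : ℕ) (hn : 2 ≤ n)
    (lam : ℕ → ℝ) (hlam : ∀ i, 1 ≤ i → i < n → lam (i + 1) ≤ lam i)
    (ℓ : ℝ) (hℓ : ℓ = (∑ i ∈ Finset.Icc 1 n, lam i) / n)
    (nij : ℕ → ℕ → ℝ)
    (hpos : ∀ i j, 1 ≤ i → i < j → j ≤ n → 0 ≤ nij i j)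
    (hmax : ∀ i j, 1 ≤ i → i < j → j ≤ n → 2 ≤ j - i →
      nij i j = max (nij (i + 1) j) (nij i (j - 1)))
    (hfor : ∀ k, 1 ≤ k → k ≤ n →
      (∑ j ∈ Finset.Icc (k + 1) n, nij k j) - (∑ i ∈ Finset.Icc 1 (k - 1), nij i k) + ℓ
        = lam k)
    (Hh Hv : ℕ → ℕ → ℝ)
    (hHh : ∀ i j, Hh i j = ∑ l ∈ Finset.Icc (j + 1) n, nij i l)
    (hHv : ∀ i j, Hv i j = ∑ l ∈ Finset.Icc 1 (i - 1), nij l j)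
    (δ : ℕ → ℕ → ℝ)
    (hδ : ∀ i j, 1 ≤ i → i ≤ j → j ≤ n → δ j i = Hh i j - Hv i j + ℓ) :
    (∀ k, 1 ≤ k → k ≤ n → δ k k = lam k) ∧
    (∀ i j, 1 ≤ j → j ≤ i → i ≤ n - 1 → 0 ≤ δ i j - δ (i + 1) j) ∧
    (∀ i j, 2 ≤ j → j ≤ i → i ≤ n → 0 ≤ δ i (j - 1) - δ i j) ∧
    (∀ i j, 1 ≤ j → j < i → i ≤ n →
      (if i < n then min (δ i j - δ (i + 1) j) (δ i j - δ i (j + 1))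
        else δ i j - δ i (j + 1)) =
      (if 2 ≤ j then min (δ (i - 1) j - δ i j) (δ i (j - 1) - δ i j)
        else δ (i - 1) j - δ i j)) := by
  have hf : IsIdealFilling n nij := ⟨hpos, hmax⟩
  have hδ' : ∀ i j, 1 ≤ i → i ≤ j → j ≤ n → δ j i = hookDiff n nij i j + ℓ := by
    intro i j hi hij hj
    rw [hδ i j hi hij hj, hHh, hHv, hookDiff]
  have hvert : ∀ i j, 1 ≤ j → j ≤ i → i < n → δ i j - δ (i + 1) j = verticalGap nij j i := by
    intro i j hj hji hi
    rw [hδ' j i hj hji hi.le, hδ' j (i + 1) hj (by omega) hi, add_sub_add_right_eq_sub,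
      hookDiff_sub_succ_right nij hi]
  have hhor : ∀ i j, 1 ≤ j → j < i → i ≤ n →
      δ i j - δ i (j + 1) = horizontalGap n nij j i := by
    intro i j hj hji hi
    rw [hδ' j i hj hji.le hi, hδ' (j + 1) i (by omega) hji hi, add_sub_add_right_eq_sub,
      hookDiff_sub_succ_left n nij i hj]
  refine ⟨fun k hk hkn => ?_, fun i j hj hji hi => ?_, fun i j hj hji hi => ?_,
    fun i j hj hji hi => ?_⟩
  · rw [hδ k k hk le_rfl hkn, hHh, hHv, hfor k hk hkn]
  · rw [hvert i j hj hji (by omega)]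
    exact (hpos j (i + 1) hj (by omega) (by omega)).trans (hf.le_verticalGap hji (by omega))
  · obtain ⟨j, rfl⟩ := Nat.exists_eq_add_of_le' (by omega : 1 ≤ j)
    rw [Nat.add_sub_cancel, hhor i j (by omega) hji hi]
    exact (hpos j i (by omega) hji hi).trans (hf.le_horizontalGap (by omega) hji)
  · trans nij j i
    · rw [hhor i j hj hji hi]
      split_ifs with h
      · rw [hvert i j hj hji.le h, hf.min_incoming hj hji h]
      · exact horizontalGap_eq fun l hl hln => by omega
    · obtain ⟨i, rfl⟩ := Nat.exists_eq_add_of_le' (by omega : 1 ≤ i)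
      rw [Nat.add_sub_cancel, hvert i j hj (by omega) (by omega)]
      split_ifs with h
      · obtain ⟨j, rfl⟩ := Nat.exists_eq_add_of_le' (by omega : 1 ≤ j)
        rw [Nat.add_sub_cancel, hhor (i + 1) j (by omega) (by omega) hi,
          hf.min_outgoing (by omega) (by omega) hi]
      · exact (verticalGap_eq fun l hl hlj => by omega).symm
end

section
/- Let n ≥ 2, λ = (λ_1 ≥ λ_2 ≥ … ≥ λ_n) ∈ ℝⁿ, ℓ := (1/n)Σ_i λ_i, and let δ be a real-valued function on the vertices of the Givental quiver such that δ_{v_{kk}} = λ_k for all k and such that, with ρ_a := δ_{h(a)} − δ_{t(a)}, the tropical critical point conditions min_{a : h(a)=v} ρ_a = min_{a : t(a)=v} ρ_a hold at every dot vertex v. Define n_{ij} := min_{a : h(a) = v_{ji}} ρ_a for 1 ≤ i < j ≤ n. Then {n_{ij}} is an ideal filling for λ: n_{ij} ≥ 0 for all i < j, n_{ij} = max(n_{i+1,j}, n_{i,j−1}) whenever j − i ≥ 2, and Σ_{j>k} n_{kj} − Σ_{i<k} n_{ik} + ℓ = λ_k for every k. -/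
open Matrix

/-- `m r c` is the common value, at each dot vertex `(r, c)` of the Givental quiver, of the minimum
of `ρ` over the incoming arrows and over the outgoing arrows. -/
structure IsTropicalCritical (n : ℕ) (δ m : ℕ → ℕ → ℝ) : Prop where
  incoming : ∀ r c, 1 ≤ c → c < r → r < n →
    m r c = min (δ r c - δ (r + 1) c) (δ r c - δ r (c + 1))
  incoming_bottom : ∀ c, 1 ≤ c → c < n → m n c = δ n c - δ n (c + 1)
  outgoing : ∀ r c, 1 ≤ c → c < r → r + 1 ≤ n →
    m (r + 1) (c + 1) = min (δ r (c + 1) - δ (r + 1) (c + 1)) (δ (r + 1) c - δ (r + 1) (c + 1))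
  outgoing_left : ∀ r, 1 ≤ r → r + 1 ≤ n → m (r + 1) 1 = δ r 1 - δ (r + 1) 1

namespace IsTropicalCritical

variable {n : ℕ} {δ m : ℕ → ℕ → ℝ}

theorem box (h : IsTropicalCritical n δ m) {r c : ℕ} (hc : 1 ≤ c) (hcr : c < r) (hr : r + 1 ≤ n) :
    m r c - m (r + 1) (c + 1) = δ r c + δ (r + 1) (c + 1) - δ r (c + 1) - δ (r + 1) c := by
  rw [h.incoming r c hc hcr (by omega), h.outgoing r c hc hcr hr]
  rcases le_total (δ (r + 1) c) (δ r (c + 1)) with hle | hle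
  · rw [min_eq_right (by linarith), min_eq_right (by linarith)]; ring
  · rw [min_eq_left (by linarith), min_eq_left (by linarith)]; ring

theorem le_incoming_right (h : IsTropicalCritical n δ m) {r c : ℕ} (hc : 1 ≤ c) (hcr : c < r)
    (hr : r ≤ n) : m r c ≤ δ r c - δ r (c + 1) := by
  rcases hr.lt_or_eq with hr | rfl
  · rw [h.incoming r c hc hcr hr]; exact min_le_right _ _
  · exact (h.incoming_bottom c hc hcr).le

theorem le_incoming_below (h : IsTropicalCritical n δ m) {r c : ℕ} (hc : 1 ≤ c) (hcr : c < r)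
    (hr : r < n) : m r c ≤ δ r c - δ (r + 1) c := by
  rw [h.incoming r c hc hcr hr]; exact min_le_left _ _

theorem le_outgoing_up (h : IsTropicalCritical n δ m) {r c : ℕ} (hc : 1 ≤ c) (hcr : c ≤ r)
    (hr : r + 1 ≤ n) : m (r + 1) c ≤ δ r c - δ (r + 1) c := by
  obtain ⟨c, rfl⟩ : ∃ d, c = d + 1 := ⟨c - 1, by omega⟩
  rcases Nat.eq_zero_or_pos c with rfl | hc'
  · exact (h.outgoing_left r (by omega) hr).le
  · rw [h.outgoing r c hc' (by omega) hr]; exact min_le_left _ _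

theorem le_outgoing_left (h : IsTropicalCritical n δ m) {r c : ℕ} (hc : 1 ≤ c) (hcr : c + 1 < r)
    (hr : r ≤ n) : m r (c + 1) ≤ δ r c - δ r (c + 1) := by
  obtain ⟨r, rfl⟩ : ∃ s, r = s + 1 := ⟨r - 1, by omega⟩
  rw [h.outgoing r c hc (by omega) hr]; exact min_le_right _ _

theorem mono (h : IsTropicalCritical n δ m) (e : ℕ) : ∀ r c, 1 ≤ c → c < r → r + 1 ≤ n →
    n + c ≤ r + e → m r c ≤ m (r + 1) c ∧ m (r + 1) (c + 1) ≤ m (r + 1) c := by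
  induction e with
  | zero => intro r c _ _ _ _; omega
  | succ e ih =>
    intro r c hc hcr hr he
    constructor
    · have up := h.le_incoming_below hc hcr (by omega)
      obtain ⟨c, rfl⟩ : ∃ d, c = d + 1 := ⟨c - 1, by omega⟩
      rcases Nat.eq_zero_or_pos c with rfl | hc'
      · rw [zero_add] at up ⊢
        linarith [h.outgoing_left r (by omega) hr]
      · have out := h.outgoing r c hc' (by omega) hr
        rcases min_choice (δ r (c + 1) - δ (r + 1) (c + 1))
          (δ (r + 1) c - δ (r + 1) (c + 1)) with hm | hm
        · linarith
        · have hF := ih r c hc' (by omega) hr (by omega)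
          linarith [h.box hc' (by omega : c < r) hr, h.le_outgoing_left hc' hcr (by omega),
            h.le_incoming_right hc' (by omega : c < r + 1) hr]
    · have left := h.le_outgoing_left hc (by omega : c + 1 < r + 1) hr
      rcases hr.lt_or_eq with hr' | hr'
      · have inc := h.incoming (r + 1) c hc (by omega) hr'
        rcases min_choice (δ (r + 1) c - δ (r + 1 + 1) c)
          (δ (r + 1) c - δ (r + 1) (c + 1)) with hm | hm
        · have hE := ih (r + 1) c hc (by omega) hr' (by omega)
          linarith [h.box hc (by omega : c < r + 1) hr',
            h.le_incoming_below (by omega : 1 ≤ c + 1) (by omega : c + 1 < r + 1) hr',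
            h.le_outgoing_up hc (by omega : c ≤ r + 1) hr']
        · linarith
      · subst hr'
        linarith [h.incoming_bottom c hc (by omega)]

theorem eq_max (h : IsTropicalCritical n δ m) {r c : ℕ} (hc : 1 ≤ c) (hcr : c < r)
    (hr : r + 1 ≤ n) : m (r + 1) c = max (m (r + 1) (c + 1)) (m r c) := by
  obtain ⟨hA, hD⟩ := h.mono n r c hc hcr hr (by omega)
  refine le_antisymm ?_ (max_le hD hA)
  have hbox := h.box hc hcr hr
  have hright := h.le_incoming_right hc (by omega : c < r + 1) hr
  have hup := h.le_outgoing_up hc hcr.le hr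
  have hinc := h.incoming r c hc hcr (by omega)
  have hout := h.outgoing r c hc hcr hr
  rw [le_max_iff]
  rcases min_choice (δ r c - δ (r + 1) c) (δ r c - δ r (c + 1)) with h1 | h1
  · right; linarith
  rcases min_choice (δ r (c + 1) - δ (r + 1) (c + 1)) (δ (r + 1) c - δ (r + 1) (c + 1))
    with h2 | h2
  · rcases le_total (m r c) (m (r + 1) (c + 1)) with h3 | h3
    · left; linarith
    · right; linarith
  · left; linarith

theorem sum_column_sub (h : IsTropicalCritical n δ m) {k : ℕ} (hk : 1 ≤ k) {t : ℕ} (hkt : k < t)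
    (ht : t ≤ n) : (∑ j ∈ Finset.Icc t n, m j k) - ∑ j ∈ Finset.Icc (t + 1) n, m j (k + 1)
      = δ t k - δ t (k + 1) := by
  induction ht using Nat.decreasingInduction with
  | self => simp [h.incoming_bottom k hk hkt]
  | of_succ t ht ih =>
    have := ih (by omega)
    rw [← Finset.add_sum_Ioc_eq_sum_Icc (by omega : t ≤ n),
      ← Finset.add_sum_Ioc_eq_sum_Icc (by omega : t + 1 ≤ n)]
    rw [← Finset.Icc_add_one_left_eq_Ioc, ← Finset.Icc_add_one_left_eq_Ioc]
    linarith [h.box hk hkt ht]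

theorem sum_row_sub (h : IsTropicalCritical n δ m) {r : ℕ} (hr : r + 1 ≤ n) (c : ℕ)
    (hcr : c < r) : (∑ i ∈ Finset.Icc 1 (c + 1), m (r + 1) i) - ∑ i ∈ Finset.Icc 1 c, m r i
      = δ r (c + 1) - δ (r + 1) (c + 1) := by
  induction c with
  | zero => simp [h.outgoing_left r (by omega) hr]
  | succ c ih =>
    have := ih (by omega)
    rw [Finset.sum_Icc_succ_top (by omega : 1 ≤ c + 1 + 1),
      Finset.sum_Icc_succ_top (by omega : 1 ≤ c + 1) (m r)]
    linarith [h.box (by omega : 1 ≤ c + 1) hcr hr]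

theorem weight_sub (h : IsTropicalCritical n δ m) {k : ℕ} (hk : 1 ≤ k) (hkn : k + 1 ≤ n) :
    ((∑ j ∈ Finset.Icc (k + 1) n, m j k) - ∑ i ∈ Finset.Icc 1 (k - 1), m k i) -
      ((∑ j ∈ Finset.Icc (k + 1 + 1) n, m j (k + 1)) - ∑ i ∈ Finset.Icc 1 k, m (k + 1) i)
      = δ k k - δ (k + 1) (k + 1) := by
  have h1 := h.sum_column_sub hk (Nat.lt_succ_self k) hkn
  have h2 := h.sum_row_sub hkn (k - 1) (by omega)
  rw [Nat.sub_add_cancel hk] at h2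
  linarith

theorem weight_eq (h : IsTropicalCritical n δ m) {k : ℕ} (hk : 1 ≤ k) (hkn : k ≤ n) :
    (∑ j ∈ Finset.Icc (k + 1) n, m j k) - (∑ i ∈ Finset.Icc 1 (k - 1), m k i)
      + (∑ i ∈ Finset.Icc 1 n, δ i i) / n = δ k k := by
  set f : ℕ → ℝ := fun k =>
    (∑ j ∈ Finset.Icc (k + 1) n, m j k) - ∑ i ∈ Finset.Icc 1 (k - 1), m k i with hf
  have hconst : ∀ k, 1 ≤ k → k ≤ n → f k = δ k k + (f 1 - δ 1 1) := by
    intro k hk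
    induction k, hk using Nat.le_induction with
    | base => intro _; ring
    | succ k hk ih =>
      intro hkn
      have h1 := ih (by omega)
      have h2 := h.weight_sub hk hkn
      simp only [hf, Nat.add_sub_cancel] at h1 h2 ⊢
      linarith
  have hsum : ∑ k ∈ Finset.Icc 1 n, f k = 0 := by
    simp only [hf, Finset.sum_sub_distrib]
    rw [sub_eq_zero]
    apply Finset.sum_comm'
    intro x y
    simp only [Finset.mem_Icc]
    omega
  have hsum' : ∑ k ∈ Finset.Icc 1 n, f k
      = (∑ k ∈ Finset.Icc 1 n, δ k k) + n * (f 1 - δ 1 1) := by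
    rw [Finset.sum_congr rfl fun k hk => hconst k (Finset.mem_Icc.1 hk).1 (Finset.mem_Icc.1 hk).2,
      Finset.sum_add_distrib]
    simp [mul_sub]
  have hn : (n : ℝ) ≠ 0 := by
    have : n ≠ 0 := by omega
    exact_mod_cast this
  have hdiv : (∑ i ∈ Finset.Icc 1 n, δ i i) / n = -(f 1 - δ 1 1) := by
    rw [div_eq_iff hn]; linarith
  have := hconst k hk hkn
  simp only [hf] at this hdiv
  linarith

theorem le_of_forall_subdiagonal (h : IsTropicalCritical n δ m) {x : ℝ}
    (hx : ∀ k, 1 ≤ k → k + 1 ≤ n → x ≤ m (k + 1) k) {r c : ℕ} (hc : 1 ≤ c) (hcr : c < r)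
    (hr : r ≤ n) : x ≤ m r c := by
  induction r, hcr using Nat.le_induction with
  | base => exact hx c hc hr
  | succ r hcr ih =>
    exact (ih (by omega)).trans (h.mono n r c hc hcr hr (by omega)).1

theorem column_le_of_min (h : IsTropicalCritical n δ m) {k : ℕ} (hk : 1 ≤ k)
    (hmin : ∀ l, 1 ≤ l → l + 1 ≤ n → m (k + 1) k ≤ m (l + 1) l) {j : ℕ} (hj : k + 2 ≤ j)
    (hjn : j ≤ n) : m j k ≤ m j (k + 1) := by
  induction j, hj using Nat.le_induction with
  | base =>
    rw [h.eq_max hk (Nat.lt_succ_self k) hjn]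
    exact max_le le_rfl (hmin (k + 1) (by omega) hjn)
  | succ j hj ih =>
    rw [h.eq_max hk (by omega) hjn]
    exact max_le le_rfl ((ih (by omega)).trans
      (h.mono n j (k + 1) (by omega) (by omega) hjn (by omega)).1)

theorem row_le_of_min (h : IsTropicalCritical n δ m) {k : ℕ} (hkn : k + 1 ≤ n)
    (hmin : ∀ l, 1 ≤ l → l + 1 ≤ n → m (k + 1) k ≤ m (l + 1) l) {i : ℕ} (hi : 1 ≤ i)
    (hik : i < k) : m (k + 1) i ≤ m k i := by
  obtain ⟨k, rfl⟩ : ∃ l, k = l + 1 := ⟨k - 1, by omega⟩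
  have hik' : i ≤ k := by omega
  induction hik' using Nat.decreasingInduction with
  | self =>
    rw [h.eq_max hi (Nat.lt_succ_self k) hkn]
    exact max_le (hmin k hi (by omega)) le_rfl
  | of_succ i hlt ih =>
    rw [h.eq_max hi (by omega) hkn]
    exact max_le ((ih (by omega) (by omega)).trans
      (h.mono n k i hi hlt (by omega) (by omega)).2) le_rfl

theorem nonneg (h : IsTropicalCritical n δ m)
    (hδ : ∀ k, 1 ≤ k → k < n → δ (k + 1) (k + 1) ≤ δ k k) {r c : ℕ} (hc : 1 ≤ c) (hcr : c < r)
    (hr : r ≤ n) : 0 ≤ m r c := by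
  obtain ⟨k, hk, hmin⟩ := Finset.exists_min_image (Finset.Icc 1 (n - 1)) (fun k => m (k + 1) k)
    ⟨1, Finset.mem_Icc.2 (by omega)⟩
  obtain ⟨hk, hkn⟩ := Finset.mem_Icc.1 hk
  replace hkn : k + 1 ≤ n := by omega
  replace hmin : ∀ l, 1 ≤ l → l + 1 ≤ n → m (k + 1) k ≤ m (l + 1) l :=
    fun l hl hln => hmin l (Finset.mem_Icc.2 (by omega))
  suffices 0 ≤ m (k + 1) k from
    h.le_of_forall_subdiagonal (fun l hl hln => this.trans (hmin l hl hln)) hc hcr hr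
  have hw := h.weight_sub hk hkn
  have hcol : ∑ j ∈ Finset.Icc (k + 1 + 1) n, m j k
      ≤ ∑ j ∈ Finset.Icc (k + 1 + 1) n, m j (k + 1) :=
    Finset.sum_le_sum fun j hj =>
      h.column_le_of_min hk hmin (Finset.mem_Icc.1 hj).1 (Finset.mem_Icc.1 hj).2
  have hrow : ∑ i ∈ Finset.Icc 1 (k - 1), m (k + 1) i ≤ ∑ i ∈ Finset.Icc 1 (k - 1), m k i :=
    Finset.sum_le_sum fun i hi =>
      h.row_le_of_min hkn hmin (Finset.mem_Icc.1 hi).1 (by have := Finset.mem_Icc.1 hi; omega)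
  have hcol_top : ∑ j ∈ Finset.Icc (k + 1) n, m j k
      = m (k + 1) k + ∑ j ∈ Finset.Icc (k + 1 + 1) n, m j k := by
    rw [← Finset.add_sum_Ioc_eq_sum_Icc hkn, ← Finset.Icc_add_one_left_eq_Ioc]
  have hrow_top : ∑ i ∈ Finset.Icc 1 k, m (k + 1) i
      = (∑ i ∈ Finset.Icc 1 (k - 1), m (k + 1) i) + m (k + 1) k := by
    obtain ⟨k, rfl⟩ : ∃ l, k = l + 1 := ⟨k - 1, by omega⟩
    exact Finset.sum_Icc_succ_top (by omega) _
  linarith [hδ k hk (by omega)]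

end IsTropicalCritical

/-- from a solution δ of the tropical critical point conditions with
star-vertex values λ_k, the numbers n_{ij} := min over arrows with head v_{ji} of
ρ_a form an ideal filling for λ. -/
theorem stmt16
    (n : ℕ) (hn : 2 ≤ n)
    (lam : ℕ → ℝ) (hlam : ∀ i, 1 ≤ i → i < n → lam (i + 1) ≤ lam i)
    (ℓ : ℝ) (hℓ : ℓ = (∑ i ∈ Finset.Icc 1 n, lam i) / n)
    (δ : ℕ → ℕ → ℝ)
    (hstar : ∀ k, 1 ≤ k → k ≤ n → δ k k = lam k)
    (htrop : (∀ i j, 1 ≤ j → j < i → i ≤ n →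
      (if i < n then min (δ i j - δ (i + 1) j) (δ i j - δ i (j + 1))
        else δ i j - δ i (j + 1)) =
      (if 2 ≤ j then min (δ (i - 1) j - δ i j) (δ i (j - 1) - δ i j)
        else δ (i - 1) j - δ i j)))
    (nij : ℕ → ℕ → ℝ)
    (hnij : ∀ i j, 1 ≤ i → i < j → j ≤ n →
      nij i j = if j < n then min (δ j i - δ (j + 1) i) (δ j i - δ j (i + 1))
        else δ j i - δ j (i + 1)) :
    (∀ i j, 1 ≤ i → i < j → j ≤ n → 0 ≤ nij i j) ∧
    (∀ i j, 1 ≤ i → i < j → j ≤ n → 2 ≤ j - i →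
      nij i j = max (nij (i + 1) j) (nij i (j - 1))) ∧
    (∀ k, 1 ≤ k → k ≤ n →
      (∑ j ∈ Finset.Icc (k + 1) n, nij k j) - (∑ i ∈ Finset.Icc 1 (k - 1), nij i k) + ℓ
        = lam k) := by
  have h : IsTropicalCritical n δ fun r c => nij c r := by
    refine ⟨fun r c hc hcr hr => ?_, fun c hc hcn => ?_, fun r c hc hcr hr => ?_,
      fun r hr hrn => ?_⟩
    · rw [hnij c r hc hcr hr.le, if_pos hr]
    · rw [hnij c n hc hcn le_rfl, if_neg (lt_irrefl n)]
    · rw [hnij (c + 1) (r + 1) (by omega) (by omega) hr,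
        htrop (r + 1) (c + 1) (by omega) (by omega) hr, if_pos (by omega)]
      simp only [Nat.add_sub_cancel]
    · rw [hnij 1 (r + 1) le_rfl (by omega) hrn, htrop (r + 1) 1 le_rfl (by omega) hrn,
        if_neg (by omega), Nat.add_sub_cancel]
  have hℓ' : ℓ = (∑ i ∈ Finset.Icc 1 n, δ i i) / n := by
    rw [hℓ, Finset.sum_congr rfl fun i hi =>
      (hstar i (Finset.mem_Icc.1 hi).1 (Finset.mem_Icc.1 hi).2).symm]
  refine ⟨fun i j hi hij hj => h.nonneg (fun k hk hkn => ?_) hi hij hj,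
    fun i j hi hij hj hji => ?_, fun k hk hkn => ?_⟩
  · rw [hstar k hk hkn.le, hstar (k + 1) (by omega) hkn]
    exact hlam k hk hkn
  · obtain ⟨j, rfl⟩ : ∃ s, j = s + 1 := ⟨j - 1, by omega⟩
    exact h.eq_max hi (by omega) hj
  · rw [hℓ', ← hstar k hk hkn]
    exact h.weight_eq hk hkn
end

section
/- Let n ≥ 2 and let δ be a real-valued function on the vertices of the Givental quiver such that, with ρ_a := δ_{h(a)} − δ_{t(a)}, the tropical critical point conditions min_{a : h(a)=v} ρ_a = min_{a : t(a)=v} ρ_a hold at every dot vertex v. Define π(v) := min_{a : h(a)=v} ρ_a for every dot vertex v. Then for all 1 ≤ i < j ≤ n with j − i ≥ 2: π(v_{ji}) = max(π(v_{j, i+1}), π(v_{j−1, i})). -/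
open Matrix

/-- The comparison forced on three arrows of a commuting square in which `D` is the smaller of the
two arrows at the corner shared with `A`, when the square satisfies the max recursion. -/
theorem le_of_square_of_max_recursion {A D L T X q p : ℝ}
    (hq : q = min A D) (hqA : q < A) (hsq : A + T = L + D)
    (hp : p = max q (min L T)) (hpD : p ≤ D) (hX : min A X ≤ T) : X ≤ q := by
  have hD : q = D := by
    rcases min_choice A D with h | h <;> rw [h] at hq
    · exact absurd hq hqA.ne
    · exact hq
  have hTL : T ≤ L := by linarith
  rw [min_eq_right hTL] at hp
  have hTq : T ≤ q := (le_max_right q T).trans (hp ▸ hpD.trans hD.ge)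
  rcases min_le_iff.1 hX with h | h <;> linarith

/-- In a commuting square with `A + B = A' + B'`, a lower bound `q` of `A` and `B` which forces
`B'` (resp. `A'`) below it whenever it differs from `A` (resp. `B`) is the max of the two mins. -/
theorem eq_max_min_of_square {A B A' B' q : ℝ} (hsq : A + B = A' + B')
    (hqA : q ≤ A) (hqB : q ≤ B) (hA : q < A → B' ≤ q) (hB : q < B → A' ≤ q) :
    q = max (min B A') (min A B') := by
  rcases hqA.eq_or_lt with rfl | h1 <;> rcases hqB.eq_or_lt with h2 | h2
  · subst h2
    rcases le_total A' q with h | h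
    · rw [min_eq_right h, min_eq_left (by linarith), max_eq_right h]
    · rw [min_eq_left h, min_eq_right (by linarith), max_eq_left (by linarith)]
  · have := hB h2
    rw [min_eq_right (by linarith), min_eq_left (by linarith), max_eq_right this]
  · subst h2
    have := hA h1
    rw [min_eq_left (by linarith), min_eq_right (by linarith), max_eq_left this]
  · linarith [hA h1, hB h2]

/-- for a solution δ of the tropical critical point conditions,
the function π(v) := min over arrows with head v of ρ_a satisfies the max recursion
π(v_{ji}) = max(π(v_{j,i+1}), π(v_{j−1,i})) for j − i ≥ 2.
Here `π r c` is π at the dot vertex v_{rc}. -/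
theorem stmt17
    (n : ℕ) (hn : 2 ≤ n)
    (δ : ℕ → ℕ → ℝ)
    (htrop : (∀ i j, 1 ≤ j → j < i → i ≤ n →
      (if i < n then min (δ i j - δ (i + 1) j) (δ i j - δ i (j + 1))
        else δ i j - δ i (j + 1)) =
      (if 2 ≤ j then min (δ (i - 1) j - δ i j) (δ i (j - 1) - δ i j)
        else δ (i - 1) j - δ i j)))
    (π : ℕ → ℕ → ℝ)
    (hπ : ∀ i j, 1 ≤ j → j < i → i ≤ n →
      π i j = if i < n then min (δ i j - δ (i + 1) j) (δ i j - δ i (j + 1))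
        else δ i j - δ i (j + 1)) :
    ∀ i j, 1 ≤ i → i + 2 ≤ j → j ≤ n →
      π j i = max (π j (i + 1)) (π (j - 1) i) := by
  have hin : ∀ i j, 1 ≤ j → j < i → i < n →
      π i j = min (δ i j - δ (i + 1) j) (δ i j - δ i (j + 1)) := by
    intro i j h1 h2 h3
    rw [hπ i j h1 h2 h3.le, if_pos h3]
  have hin_le : ∀ i j, 1 ≤ j → j < i → i ≤ n → π i j ≤ δ i j - δ i (j + 1) := by
    intro i j h1 h2 h3
    rw [hπ i j h1 h2 h3]
    split_ifs
    · exact min_le_right _ _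
    · exact le_rfl
  have hout' : ∀ i j, 1 ≤ j → j < i → i ≤ n →
      π i j = if 2 ≤ j then min (δ (i - 1) j - δ i j) (δ i (j - 1) - δ i j)
        else δ (i - 1) j - δ i j := by
    intro i j h1 h2 h3
    rw [hπ i j h1 h2 h3, htrop i j h1 h2 h3]
  have hout : ∀ i j, 1 ≤ j → j + 1 < i → i ≤ n →
      π i (j + 1) = min (δ (i - 1) (j + 1) - δ i (j + 1)) (δ i j - δ i (j + 1)) := by
    intro i j h1 h2 h3
    rw [hout' i (j + 1) (by omega) h2 h3, if_pos (by omega), Nat.add_sub_cancel]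
  have hout_le : ∀ i j, 1 ≤ j → j < i → i ≤ n → π i j ≤ δ (i - 1) j - δ i j := by
    intro i j h1 h2 h3
    rw [hout' i j h1 h2 h3]
    split_ifs
    · exact min_le_left _ _
    · exact le_rfl
  intro i j
  induction hk : n + i - j using Nat.strong_induction_on generalizing i j with
  | _ k ih =>
  intro hi hij hjn
  obtain ⟨m, rfl⟩ : ∃ m, j = m + 1 := ⟨j - 1, by omega⟩
  rw [Nat.add_sub_cancel, hout (m + 1) i hi (by omega) hjn, hin m i hi (by omega) (by omega),
    Nat.add_sub_cancel, min_comm (δ m (i + 1) - δ (m + 1) (i + 1))]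
  refine eq_max_min_of_square (by ring) (hout_le (m + 1) i hi (by omega) hjn)
    (hin_le (m + 1) i hi (by omega) hjn) ?_ ?_
  · intro hlt
    have h2 : 2 ≤ i := by
      by_contra h
      rw [hout' (m + 1) i hi (by omega) hjn, if_neg h] at hlt
      exact lt_irrefl _ hlt
    obtain ⟨l, rfl⟩ : ∃ l, i = l + 1 := ⟨i - 1, by omega⟩
    have hrec := ih _ (by omega) l (m + 1) rfl (by omega) (by omega) hjn
    rw [Nat.add_sub_cancel, hin m l (by omega) (by omega) (by omega)] at hrec
    refine le_of_square_of_max_recursion (hout (m + 1) l (by omega) (by omega) hjn) hlt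
      (by simp only [Nat.add_sub_cancel]; ring) hrec
      (hin_le (m + 1) l (by omega) (by omega) hjn) ?_
    rw [Nat.add_sub_cancel, ← hin m (l + 1) hi (by omega) (by omega),
      hout m l (by omega) (by omega) (by omega)]
    exact min_le_right _ _
  · intro hlt
    have h2 : m + 1 < n := by
      by_contra h
      rw [hπ (m + 1) i hi (by omega) hjn, if_neg h] at hlt
      exact lt_irrefl _ hlt
    have hrec := ih _ (by omega) i (m + 2) rfl hi (by omega) h2
    rw [max_comm, hout (m + 2) i hi (by omega) h2, min_comm (_ - _)] at hrec
    refine le_of_square_of_max_recursion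
      ((hin (m + 1) i hi (by omega) h2).trans (min_comm _ _)) hlt (by
        show _ + (δ (m + 1) (i + 1) - δ (m + 2) (i + 1)) = _
        ring) hrec (hout_le (m + 2) i hi (by omega) h2) ?_
    have h3 := hout (m + 1) i hi (by omega) hjn
    rw [Nat.add_sub_cancel, min_comm] at h3
    rw [← h3, hin (m + 1) (i + 1) (by omega) (by omega) h2]
    exact min_le_left _ _
end

section
/- Let n ≥ 2, ℓ ∈ ℝ, and let δ be a real-valued function on the vertices of the Givental quiver such that, with ρ_a := δ_{h(a)} − δ_{t(a)}, the tropical critical point conditions min_{a : h(a)=v} ρ_a = min_{a : t(a)=v} ρ_a hold at every dot vertex v, and such that δ_{v_{n1}} = ℓ. Define π(v) := min_{a : h(a)=v} ρ_a for every dot vertex v. Then for every vertex v_{ij} (1 ≤ j ≤ i ≤ n): δ_{v_{ij}} = Σ_{k=i+1}^{n} π(v_{kj}) − Σ_{k=1}^{j−1} π(v_{ik}) + ℓ (empty sums equal 0). -/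
open Matrix

/-- for a solution δ of the tropical critical point conditions with
δ_{v_{n1}} = ℓ, the value at every vertex is
δ_{v_{ij}} = Σ_{below} π − Σ_{left} π + ℓ. -/
theorem stmt18
    (n : ℕ) (hn : 2 ≤ n) (ℓ : ℝ)
    (δ : ℕ → ℕ → ℝ)
    (htrop : (∀ i j, 1 ≤ j → j < i → i ≤ n →
      (if i < n then min (δ i j - δ (i + 1) j) (δ i j - δ i (j + 1))
        else δ i j - δ i (j + 1)) =
      (if 2 ≤ j then min (δ (i - 1) j - δ i j) (δ i (j - 1) - δ i j)
        else δ (i - 1) j - δ i j)))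
    (hbase : δ n 1 = ℓ)
    (π : ℕ → ℕ → ℝ)
    (hπ : ∀ i j, 1 ≤ j → j < i → i ≤ n →
      π i j = if i < n then min (δ i j - δ (i + 1) j) (δ i j - δ i (j + 1))
        else δ i j - δ i (j + 1)) :
    ∀ i j, 1 ≤ j → j ≤ i → i ≤ n →
      δ i j = (∑ k ∈ Finset.Icc (i + 1) n, π k j)
        - (∑ k ∈ Finset.Icc 1 (j - 1), π i k) + ℓ := by
  have hrow : ∀ j, 1 ≤ j → j < n → π n j = δ n j - δ n (j + 1) := by
    intro j h1 h2
    simpa using hπ n j h1 h2 le_rfl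
  have hcol : ∀ i, 1 ≤ i → i + 1 ≤ n → π (i + 1) 1 = δ i 1 - δ (i + 1) 1 := by
    intro i h1 h2
    rw [hπ (i + 1) 1 le_rfl (by omega) h2, htrop (i + 1) 1 le_rfl (by omega) h2]
    simp
  -- On each square of the quiver the two minima add up via `min + max = sum`.
  have hsq : ∀ i j, 1 ≤ j → j < i → i < n →
      δ i (j + 1) + δ (i + 1) j - δ (i + 1) (j + 1) - δ i j =
        π (i + 1) (j + 1) - π i j := by
    intro i j h1 h2 h3
    have hin := hπ i j h1 h2 h3.le
    have hout := (hπ (i + 1) (j + 1) (by omega) (by omega) h3).trans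
      (htrop (i + 1) (j + 1) (by omega) (by omega) h3)
    rw [if_pos h3] at hin
    rw [if_pos (by omega), Nat.add_sub_cancel, Nat.add_sub_cancel] at hout
    rw [hin, hout]
    rcases le_total (δ (i + 1) j) (δ i (j + 1)) with h | h
    · rw [min_eq_right (by linarith), min_eq_right (by linarith)]
      ring
    · rw [min_eq_left (by linarith), min_eq_left (by linarith)]
      ring
  have hbelow : ∀ i j, i < n → ∑ k ∈ Finset.Icc (i + 1) n, π k j =
      π (i + 1) j + ∑ k ∈ Finset.Icc (i + 1 + 1) n, π k j := by
    intro i j h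
    rw [Finset.Icc_add_one_left_eq_Ioc (i + 1) n]
    exact (Finset.add_sum_Ioc_eq_sum_Icc (f := fun k => π k j) h).symm
  have hleft : ∀ i j, 1 ≤ j → ∑ k ∈ Finset.Icc 1 j, π i k =
      ∑ k ∈ Finset.Icc 1 (j - 1), π i k + π i j := by
    intro i j h
    obtain ⟨m, rfl⟩ := Nat.exists_eq_add_of_le' h
    exact Finset.sum_Icc_succ_top (by omega) _
  intro i j hj
  induction j, hj using Nat.le_induction generalizing i with
  | base =>
    intro h1 h2
    induction h2 using Nat.decreasingInduction with
    | self => simp [hbase]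
    | of_succ i hi ih =>
      have ih := ih (by omega)
      have hc := hcol i h1 hi
      rw [hbelow i 1 hi]
      simp only [Nat.sub_self, Finset.Icc_eq_empty_of_lt Nat.zero_lt_one,
        Finset.sum_empty] at ih ⊢
      linarith
  | succ j hj ihj =>
    intro h1 h2
    rw [Nat.add_sub_cancel, hleft i j hj]
    induction h2 using Nat.decreasingInduction with
    | self =>
      have hr := hrow j hj h1
      have ih := ihj n (by omega) le_rfl
      simp only [Finset.Icc_eq_empty_of_lt (Nat.lt_succ_self n), Finset.sum_empty] at ih ⊢
      linarith
    | of_succ i hi ih =>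
      have ih := ih (by omega)
      have hs := hsq i j hj h1 hi
      have ih₁ := ihj i (by omega) hi.le
      have ih₂ := ihj (i + 1) (by omega) hi
      rw [hbelow i j hi] at ih₁
      rw [hbelow i (j + 1) hi]
      linarith
end

section
/- Let 𝕂 be a field, n ≥ 3, and let 1 ≤ i, j ≤ n−1 with |i − j| = 1. Let m_α, m_{α+β}, m_β ∈ 𝕂ˣ with m_α + m_β ≠ 0, and define m′_α := m_{α+β}(m_α + m_β)/m_β, m′_{α+β} := m_α m_β/(m_α + m_β), and m′_β := m_{α+β}(m_α + m_β)/m_α. Then y_i(m_α⁻¹)·y_j(m_{α+β}⁻¹)·y_i(m_β⁻¹) = y_j(m′_β⁻¹)·y_i(m′_{α+β}⁻¹)·y_j(m′_α⁻¹) as n×n matrices over 𝕂. -/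
open Matrix

theorem yMat_eq_one_add_smul_single (n : ℕ) (𝕂 : Type*) [Field 𝕂] (i : ℕ) (hi : 1 ≤ i) (hin : i < n)
    (z : 𝕂) :
    yMat n 𝕂 i z = 1 + z • Matrix.single (⟨i, hin⟩ : Fin n) ⟨i - 1, by omega⟩ (1 : 𝕂) := by
  ext a b
  simp only [yMat, Matrix.add_apply, Matrix.one_apply, Matrix.smul_apply, Matrix.single_apply,
    Fin.ext_iff, smul_eq_mul, mul_ite, mul_one, mul_zero]
  split_ifs <;> first | omega | simp

/-- The braid relation for `1 + a • E`, `1 + b • F` with `E`, `F` satisfying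
`E² = F² = EFE = FEF = 0`. -/
theorem one_add_smul_braid {𝕂 A : Type*} [CommRing 𝕂] [Ring A] [Algebra 𝕂 A] {E F : A}
    (hE : E * E = 0) (hF : F * F = 0) (hEFE : E * F * E = 0) (hFEF : F * E * F = 0)
    {a b c a' b' c' : 𝕂} (hb : b = a' + c') (hb' : b' = a + c)
    (hab : a * b = b' * c') (hbc : b * c = a' * b') :
    (1 + a • E) * (1 + b • F) * (1 + c • E) = (1 + a' • F) * (1 + b' • E) * (1 + c' • F) := by
  have hl : (1 + a • E) * (1 + b • F) * (1 + c • E)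
      = 1 + (a + c) • E + b • F + (a * b) • (E * F) + (b * c) • (F * E) := by
    simp only [mul_add, add_mul, one_mul, mul_one, smul_mul_smul_comm, hE, hEFE, smul_zero, add_smul]
    abel
  have hr : (1 + a' • F) * (1 + b' • E) * (1 + c' • F)
      = 1 + b' • E + (a' + c') • F + (b' * c') • (E * F) + (a' * b') • (F * E) := by
    simp only [mul_add, add_mul, one_mul, mul_one, smul_mul_smul_comm, hF, hFEF, smul_zero, add_smul]
    abel
  rw [hl, hr, ← hb, ← hb', hab, hbc]

/-- the explicit coordinate change for the braid move
y_i(m_α⁻¹)·y_j(m_{α+β}⁻¹)·y_i(m_β⁻¹) = y_j(m′_β⁻¹)·y_i(m′_{α+β}⁻¹)·y_j(m′_α⁻¹)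
when |i − j| = 1. -/
theorem stmt19
    (𝕂 : Type*) [Field 𝕂]
    (n : ℕ) (hn : 3 ≤ n)
    (i j : ℕ) (hi : 1 ≤ i) (hi' : i ≤ n - 1) (hj : 1 ≤ j) (hj' : j ≤ n - 1)
    (hij : i = j + 1 ∨ j = i + 1)
    (ma mab mb : 𝕂) (hma : ma ≠ 0) (hmab : mab ≠ 0) (hmb : mb ≠ 0)
    (hsum : ma + mb ≠ 0)
    (ma' mab' mb' : 𝕂)
    (h1 : ma' = mab * (ma + mb) / mb)
    (h2 : mab' = ma * mb / (ma + mb))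
    (h3 : mb' = mab * (ma + mb) / ma) :
    yMat n 𝕂 i ma⁻¹ * yMat n 𝕂 j mab⁻¹ * yMat n 𝕂 i mb⁻¹ =
      yMat n 𝕂 j mb'⁻¹ * yMat n 𝕂 i mab'⁻¹ * yMat n 𝕂 j ma'⁻¹ := by
  have hin : i < n := by omega
  have hjn : j < n := by omega
  subst h1 h2 h3
  simp only [yMat_eq_one_add_smul_single n 𝕂 i hi hin, yMat_eq_one_add_smul_single n 𝕂 j hj hjn]
  apply one_add_smul_braid
  · exact Matrix.single_mul_single_of_ne _ _ _ _ (by simp only [ne_eq, Fin.ext_iff]; omega) _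
  · exact Matrix.single_mul_single_of_ne _ _ _ _ (by simp only [ne_eq, Fin.ext_iff]; omega) _
  · rcases hij with h | h
    · rw [mul_assoc, Matrix.single_mul_single_of_ne (h := by simp only [ne_eq, Fin.ext_iff]; omega),
        mul_zero]
    · rw [Matrix.single_mul_single_of_ne (h := by simp only [ne_eq, Fin.ext_iff]; omega), zero_mul]
  · rcases hij with h | h
    · rw [Matrix.single_mul_single_of_ne (h := by simp only [ne_eq, Fin.ext_iff]; omega), zero_mul]
    · rw [mul_assoc, Matrix.single_mul_single_of_ne (h := by simp only [ne_eq, Fin.ext_iff]; omega),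
        mul_zero]
  · field_simp
  · field_simp
    ring
  · field_simp
  · field_simp
end
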